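/- Let Δ : ℕ → ℕ and, for each n, let H_n be a simple graph on n vertices with maximum degree at most Δ(n). Then there exists a function f : ℕ → ℝ with f(D) ≥ 0 for all D and f(D) → 0 as D → ∞ (f depends only on the degree bound, not on n or the graphs), and for each n a Builder strategy in the semirandom tree process on vertex set [n], such that the probability that Builder's graph after ⌈(1 + f(Δ(n))) · Δ(n) · n / 2⌉ rounds contains a copy of H_n tends to 1 as n → ∞. -/

import Mathlib

open Filter

/-- A spanning tree of the complete graph on `Fin n`: a connected acyclic simple graph
on vertex set `Fin n`. -/
def IsSpanningTree {n : ℕ} (T : SimpleGraph (Fin n)) : Prop := T.Connected ∧ T.IsAcyclic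

/-- The type of spanning trees of the complete graph on `Fin n`. -/
def SpanningTree (n : ℕ) : Type := {T : SimpleGraph (Fin n) // IsSpanningTree T}

/-- A Builder strategy in the semirandom tree process on `Fin n`: given the list of
previously offered spanning trees (earliest first) and the currently offered tree `T`,
Builder either chooses an edge (claiming it provided it is an edge of `T`; choosing a
non-edge of `T` yields no edge, exactly as the choice `none`). -/
def TreeStrategy (n : ℕ) : Type :=
  List (SpanningTree n) → SpanningTree n → Option (Sym2 (Fin n))

/-- The (at most one) edge claimed in a single round in which the tree `T` is offered,
after the history `hist` of previously offered trees. -/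
def treeStep {n : ℕ} (σ : TreeStrategy n) (hist : List (SpanningTree n))
    (T : SpanningTree n) : SimpleGraph (Fin n) :=
  match σ hist T with
  | none => ⊥
  | some e => SimpleGraph.fromEdgeSet ({e} ∩ T.1.edgeSet)

/-- Builder's graph resulting from playing strategy `σ` on a given list of offered trees,
where `hist` records the offers made in earlier rounds. -/
def treeBuildAux {n : ℕ} (σ : TreeStrategy n) :
    List (SpanningTree n) → List (SpanningTree n) → SimpleGraph (Fin n)
  | _, [] => ⊥
  | hist, T :: rest => treeStep σ hist T ⊔ treeBuildAux σ (hist ++ [T]) rest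

/-- Builder's graph after playing strategy `σ` on the list `offers` of offered trees. -/
def treeBuild {n : ℕ} (σ : TreeStrategy n) (offers : List (SpanningTree n)) :
    SimpleGraph (Fin n) :=
  treeBuildAux σ [] offers

/-- `G` contains a copy of `H`. -/
def ContainsCopy {n : ℕ} (G H : SimpleGraph (Fin n)) : Prop :=
  ∃ φ : Fin n → Fin n, Function.Injective φ ∧ ∀ u v : Fin n, H.Adj u v → G.Adj (φ u) (φ v)

/-- The probability that after `t` rounds of the semirandom tree process (offers being
i.i.d. uniform spanning trees of the complete graph on `Fin n`), Builder's graph,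
playing `σ`, contains a copy of `H`. -/
noncomputable def treeProb (n t : ℕ) (σ : TreeStrategy n) (H : SimpleGraph (Fin n)) : ℝ :=
  (Nat.card {ω : Fin t → SpanningTree n // ContainsCopy (treeBuild σ (List.ofFn ω)) H} : ℝ) /
    (Nat.card (SpanningTree n) : ℝ) ^ t

section Trees

open Finset
open scoped Classical

variable {n : ℕ}

noncomputable instance : Fintype (SpanningTree n) :=
  @Fintype.ofFinite _ (inferInstanceAs (Finite {T : SimpleGraph (Fin n) // IsSpanningTree T}))

/-- The number of spanning trees satisfying a property. -/
noncomputable def treeCount (p : SpanningTree n → Prop) : ℕ :=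
  #{T : SpanningTree n | p T}

lemma treeCount_eq_sum (p : SpanningTree n → Prop) :
    treeCount p = ∑ T : SpanningTree n, if p T then 1 else 0 := by
  simp [treeCount]

lemma treeCount_add_not (p q : SpanningTree n → Prop) :
    treeCount (fun T => p T ∧ q T) + treeCount (fun T => p T ∧ ¬ q T) = treeCount p := by
  unfold treeCount
  rw [← card_filter_add_card_filter_not (s := ({T : SpanningTree n | p T} : Finset _)) q]
  simp [filter_filter]

lemma IsSpanningTree.isTree {T : SimpleGraph (Fin n)} (h : IsSpanningTree T) : T.IsTree :=
  ⟨h.1, h.2⟩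

lemma IsSpanningTree.ncard_edgeSet {T : SimpleGraph (Fin n)} (h : IsSpanningTree T) :
    T.edgeSet.ncard + 1 = n := by
  have := (SimpleGraph.isTree_iff_connected_and_card.1 h.isTree).2
  rw [Nat.card_coe_set_eq, Nat.card_fin] at this
  exact this

lemma exists_isSpanningTree_exchange {T : SimpleGraph (Fin n)} (hT : IsSpanningTree T)
    {x y : Fin n} (hxy : x ≠ y) (hadj : ¬ T.Adj x y) :
    ∃ z, T.Adj x z ∧ ∃ T' : SimpleGraph (Fin n), IsSpanningTree T' ∧
      T'.edgeSet = insert s(x, y) T.edgeSet \ {s(x, z)} := by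
  obtain ⟨p, hp⟩ := (hT.1.preconnected x y).exists_isPath
  cases p with
  | nil => exact absurd rfl hxy
  | @cons _ z _ h p' =>
    rw [SimpleGraph.Walk.cons_isPath_iff] at hp
    refine ⟨z, h, ?_⟩
    have hzy : z ≠ y := by rintro rfl; exact hadj h
    set G := T ⊔ SimpleGraph.edge x y with hG
    have hTG : T ≤ G := le_sup_left
    have hGxy : G.Adj x y := by
      right; simp [SimpleGraph.edge_adj, hxy]
    have hnb : ¬ G.IsBridge s(x, z) := by
      rw [SimpleGraph.isBridge_iff_forall_walk_mem_edges]
      intro hb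
      have := hb (SimpleGraph.Walk.cons hGxy ((p'.mapLe hTG).reverse))
      rw [SimpleGraph.Walk.edges_cons, List.mem_cons] at this
      rcases this with h1 | h1
      · rw [Sym2.eq_iff] at h1
        rcases h1 with h1 | h1
        · exact hzy h1.2
        · exact hxy h1.1
      · rw [SimpleGraph.Walk.edges_reverse, List.mem_reverse] at h1
        have := SimpleGraph.Walk.fst_mem_support_of_mem_edges _ h1
        simp at this
        exact hp.2 this
    have hedge : (G.deleteEdges {s(x, z)}).edgeSet = insert s(x, y) T.edgeSet \ {s(x, z)} := by
      rw [SimpleGraph.edgeSet_deleteEdges, hG, SimpleGraph.edgeSet_sup,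
        SimpleGraph.edgeSet_edge_of_ne hxy, Set.union_comm, Set.singleton_union]
    refine ⟨_, ?_, hedge⟩
    have hcon : (G.deleteEdges {s(x, z)}).Connected :=
      (hT.1.mono hTG).connected_delete_edge_of_not_isBridge hnb
    have htree : (G.deleteEdges {s(x, z)}).IsTree := by
      rw [SimpleGraph.isTree_iff_connected_and_card]
      refine ⟨hcon, ?_⟩
      rw [Nat.card_coe_set_eq, hedge, Set.ncard_sdiff_singleton_of_mem,
        Set.ncard_insert_of_notMem]
      · simpa using hT.ncard_edgeSet
      · simpa using hadj
      · right; simpa using h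
    exact ⟨htree.1, htree.2⟩

lemma spanningTree_ext {S T : SpanningTree n} (h : S.1.edgeSet = T.1.edgeSet) : S = T :=
  Subtype.ext (SimpleGraph.edgeSet_inj.1 h)

/-- Edge exchange: trees avoiding `M` are at most `n` times as many as those which in addition
contain a prescribed edge outside `M`. -/
lemma treeCount_avoid_le (M : Set (Sym2 (Fin n))) (e : Sym2 (Fin n)) (he : ¬ e.IsDiag)
    (heM : e ∉ M) :
    treeCount (fun T : SpanningTree n => Disjoint T.1.edgeSet M) ≤
      n * treeCount (fun T : SpanningTree n => Disjoint T.1.edgeSet M ∧ e ∈ T.1.edgeSet) := by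
  induction e using Sym2.ind with
  | _ x y =>
  have hxy : x ≠ y := by simpa using he
  have key : ∀ T : SpanningTree n, ∃ q : SpanningTree n × Fin n,
      Disjoint T.1.edgeSet M → (Disjoint q.1.1.edgeSet M ∧ s(x, y) ∈ q.1.1.edgeSet) ∧
        ((s(x, y) ∈ T.1.edgeSet ∧ q.2 = x ∧ q.1 = T) ∨ (q.2 ≠ x ∧
          T.1.edgeSet = insert s(x, q.2) (q.1.1.edgeSet \ {s(x, y)}))) := by
    intro T
    by_cases hadj : T.1.Adj x y
    · exact ⟨(T, x), fun h => ⟨⟨h, by simpa using hadj⟩, .inl ⟨by simpa using hadj, rfl, rfl⟩⟩⟩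
    · obtain ⟨z, hz, T', hT', hE⟩ := exists_isSpanningTree_exchange T.2 hxy hadj
      refine ⟨(⟨T', hT'⟩, z), fun h => ⟨⟨?_, ?_⟩, .inr ⟨hz.ne', ?_⟩⟩⟩
      · simp only [hE]
        rw [Set.disjoint_left] at h ⊢
        rintro f ⟨hf, -⟩ hfM
        rcases hf with rfl | hf
        · exact heM hfM
        · exact h hf hfM
      · simp only [hE]
        refine ⟨Set.mem_insert _ _, ?_⟩
        intro h1
        simp only [Set.mem_singleton_iff, Sym2.eq_iff] at h1
        rcases h1 with h1 | h1
        · rw [h1.2] at hadj; exact hadj hz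
        · exact hxy h1.2.symm
      · simp only [hE]
        ext f
        have h1 : s(x, z) ∈ T.1.edgeSet := by simpa using hz
        have h2 : s(x, y) ∉ T.1.edgeSet := by simpa using hadj
        by_cases hf1 : f = s(x, z)
        · subst hf1; simpa using hz
        · by_cases hf2 : f = s(x, y)
          · subst hf2; simp [hf1, h2]
          · simp [hf1, hf2]
  choose g hg using key
  unfold treeCount
  calc _ ≤ #(({T : SpanningTree n | Disjoint T.1.edgeSet M ∧ s(x, y) ∈ T.1.edgeSet} :
        Finset _) ×ˢ (univ : Finset (Fin n))) := by
        apply card_le_card_of_injOn g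
        · intro T hT
          simp only [coe_filter, mem_univ, true_and, Set.mem_ofPred_eq] at hT
          simpa using (hg T hT).1
        · intro S hS T hT hST
          simp only [coe_filter, mem_univ, true_and, Set.mem_ofPred_eq] at hS hT
          rcases (hg S hS).2 with ⟨_, h1, h2⟩ | ⟨h1, h2⟩ <;>
            rcases (hg T hT).2 with ⟨_, h3, h4⟩ | ⟨h3, h4⟩
          · rw [← h2, ← h4, hST]
          · rw [← hST] at h3; exact absurd h1 h3
          · rw [hST] at h1; exact absurd h3 h1
          · rw [hST] at h2
            exact spanningTree_ext (h2.trans h4.symm)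
    _ = _ := by rw [card_product]; simp [mul_comm]

lemma treeCount_not_mem_le (M : Set (Sym2 (Fin n))) (e : Sym2 (Fin n)) (he : ¬ e.IsDiag)
    (heM : e ∉ M) :
    (treeCount (fun T : SpanningTree n => Disjoint T.1.edgeSet (insert e M)) : ℝ) ≤
      (1 - 1 / n) * treeCount (fun T : SpanningTree n => Disjoint T.1.edgeSet M) := by
  have h1 := treeCount_avoid_le M e he heM
  have h2 := treeCount_add_not (fun T : SpanningTree n => Disjoint T.1.edgeSet M)
    (fun T => e ∈ T.1.edgeSet)
  have h3 : (fun T : SpanningTree n => Disjoint T.1.edgeSet (insert e M)) =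
      fun T => Disjoint T.1.edgeSet M ∧ e ∉ T.1.edgeSet := by
    funext T
    rw [Set.disjoint_insert_right, and_comm]
  rw [h3]
  have hn : 0 < n := by
    induction e using Sym2.ind with
    | _ x y => exact x.pos
  have hn' : (0 : ℝ) < n := by exact_mod_cast hn
  set a := treeCount (fun T : SpanningTree n => Disjoint T.1.edgeSet M ∧ e ∈ T.1.edgeSet)
  set b := treeCount (fun T : SpanningTree n => Disjoint T.1.edgeSet M ∧ e ∉ T.1.edgeSet)
  set c := treeCount (fun T : SpanningTree n => Disjoint T.1.edgeSet M)
  have h1' : (c : ℝ) ≤ n * a := by exact_mod_cast h1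
  have h2' : (a : ℝ) + b = c := by exact_mod_cast h2
  have : (c : ℝ) / n ≤ a := by rw [div_le_iff₀ hn']; linarith
  have h4 : (1 - 1 / (n : ℝ)) * c = c - c / n := by ring
  rw [h4]; linarith

/-- The probability that a uniform spanning tree avoids a set of `m` edges is at most
`exp (-m/n)`. -/
lemma treeCount_avoid_le_exp (M : Finset (Sym2 (Fin n))) (hM : ∀ e ∈ M, ¬ e.IsDiag) :
    (treeCount (fun T : SpanningTree n => Disjoint T.1.edgeSet (M : Set (Sym2 (Fin n)))) : ℝ) ≤
      Real.exp (-(#M : ℝ) / n) * Fintype.card (SpanningTree n) := by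
  induction M using Finset.induction_on with
  | empty => simp [treeCount, Finset.card_univ]
  | insert e M he ih =>
    have h1 := treeCount_not_mem_le (M : Set (Sym2 (Fin n))) e (hM e (mem_insert_self _ _))
      (by simpa using he)
    have h2 := ih (fun f hf => hM f (mem_insert_of_mem hf))
    rw [coe_insert]
    refine h1.trans ?_
    have h3 : 1 - 1 / (n : ℝ) ≤ Real.exp (-(1 / n)) := by
      have := Real.add_one_le_exp (-(1 / (n : ℝ))); linarith
    calc _ ≤ Real.exp (-(1 / n)) * _ := mul_le_mul_of_nonneg_right h3 (by positivity)
      _ ≤ Real.exp (-(1 / n)) * _ := mul_le_mul_of_nonneg_left h2 (by positivity)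
      _ = _ := by
        rw [← mul_assoc, ← Real.exp_add, card_insert_of_notMem he]
        congr 2
        push_cast; ring

lemma treeCount_mem_eq {e f : Sym2 (Fin n)} (he : ¬ e.IsDiag) (hf : ¬ f.IsDiag) :
    treeCount (fun T : SpanningTree n => e ∈ T.1.edgeSet) ≤
      treeCount (fun T : SpanningTree n => f ∈ T.1.edgeSet) := by
  induction e using Sym2.ind with
  | _ a b =>
  induction f using Sym2.ind with
  | _ c d =>
  have hab : a ≠ b := by simpa using he
  have hcd : c ≠ d := by simpa using hf
  obtain ⟨π, hπ⟩ : ∃ π : Equiv.Perm (Fin n), π c = a ∧ π d = b := by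
    obtain ⟨π, hπ⟩ := Equiv.Perm.exists_extending_pair
      (![c, d]) (![a, b]) (by simpa [Function.Injective, Fin.forall_fin_two] using ⟨hcd, hcd.symm⟩)
      (by simpa [Function.Injective, Fin.forall_fin_two] using ⟨hab, hab.symm⟩)
    exact ⟨π, hπ 0, hπ 1⟩
  let g : SpanningTree n → SpanningTree n := fun T => ⟨T.1.comap π,
    (SimpleGraph.Iso.comap π T.1).connected_iff.2 T.2.1,
    (SimpleGraph.Iso.comap π T.1).isAcyclic_iff.2 T.2.2⟩
  have hg : ∀ T, s(a, b) ∈ T.1.edgeSet → s(c, d) ∈ (g T).1.edgeSet := by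
    intro T hT
    have hT' : T.1.Adj (π c) (π d) := by rw [hπ.1, hπ.2]; exact hT
    exact hT'
  unfold treeCount
  apply card_le_card_of_injOn g
  · intro T hT
    rw [mem_coe, mem_filter] at hT ⊢
    exact ⟨mem_univ _, hg T hT.2⟩
  · intro S _ T _ h
    have h1 : S.1.comap π = T.1.comap π := congrArg Subtype.val h
    refine Subtype.ext ?_
    ext x y
    have h2 := congrArg (fun G : SimpleGraph (Fin n) => G.Adj (π.symm x) (π.symm y)) h1
    simpa using h2

lemma treeCount_mem_mul (e : Sym2 (Fin n)) (he : ¬ e.IsDiag) :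
    n * treeCount (fun T : SpanningTree n => e ∈ T.1.edgeSet) ≤
      2 * Fintype.card (SpanningTree n) := by
  have hn : 2 ≤ n := by
    induction e using Sym2.ind with
    | _ x y =>
      have : x ≠ y := by simpa using he
      by_contra hc
      exact this (Fin.ext (by omega))
  have key : ∀ S : Set (Sym2 (Fin n)), (∀ f ∈ S, ¬ f.IsDiag) → S.ncard + 1 = n →
      (∑ f ∈ ({f : Sym2 (Fin n) | ¬ f.IsDiag} : Finset _), if f ∈ S then 1 else 0) = n - 1 := by
    intro S hS hc
    rw [← Finset.card_filter, filter_filter]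
    have h2 : ({f : Sym2 (Fin n) | ¬ f.IsDiag ∧ f ∈ S} : Finset _) = S.toFinset := by
      ext f
      simp only [mem_filter, mem_univ, true_and, Set.mem_toFinset]
      exact ⟨fun h => h.2, fun h => ⟨hS f h, h⟩⟩
    rw [h2, ← Set.ncard_eq_toFinset_card']
    omega
  have h1 : ∑ f ∈ ({f : Sym2 (Fin n) | ¬ f.IsDiag} : Finset _),
      treeCount (fun T : SpanningTree n => f ∈ T.1.edgeSet) =
        (n - 1) * Fintype.card (SpanningTree n) := by
    simp_rw [treeCount_eq_sum]
    rw [Finset.sum_comm, Finset.sum_congr rfl (g := fun _ => n - 1)]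
    · simp [mul_comm, Finset.card_univ]
    · intro T _
      exact key _ (fun f hf => SimpleGraph.not_isDiag_of_mem_edgeSet _ hf) T.2.ncard_edgeSet
  have h2 : #({f : Sym2 (Fin n) | ¬ f.IsDiag} : Finset _) = n.choose 2 := by
    rw [← Fintype.card_subtype, Sym2.card_subtype_not_diag, Fintype.card_fin]
  have h3 : ∑ f ∈ ({f : Sym2 (Fin n) | ¬ f.IsDiag} : Finset _),
      treeCount (fun T : SpanningTree n => e ∈ T.1.edgeSet) ≤
        (n - 1) * Fintype.card (SpanningTree n) := by
    rw [← h1]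
    exact Finset.sum_le_sum fun f hf => treeCount_mem_eq he (by simpa using hf)
  rw [Finset.sum_const, h2, smul_eq_mul] at h3
  have h4 : n.choose 2 * 2 = n * (n - 1) := by
    rw [Nat.choose_two_right]
    exact Nat.div_mul_cancel (Nat.even_mul_pred_self n).two_dvd
  have h5 : 0 < n - 1 := by omega
  refine Nat.le_of_mul_le_mul_left ?_ h5
  calc (n - 1) * (n * treeCount (fun T : SpanningTree n => e ∈ T.1.edgeSet))
      = 2 * (n.choose 2 * treeCount (fun T : SpanningTree n => e ∈ T.1.edgeSet)) := by
        rw [← mul_assoc, mul_comm (n - 1) n, ← h4]; ring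
    _ ≤ 2 * ((n - 1) * Fintype.card (SpanningTree n)) := Nat.mul_le_mul_left _ h3
    _ = _ := by ring

/-- For a set `M` of at most `n/4` edges, the uniform spanning tree meets `M` in exactly one
prescribed edge with probability at least `1/(2n)`. -/
lemma card_le_treeCount_inter_eq (M : Finset (Sym2 (Fin n))) (hM : ∀ e ∈ M, ¬ e.IsDiag)
    (hc : 4 * #M ≤ n) (e : Sym2 (Fin n)) (he : e ∈ M) :
    Fintype.card (SpanningTree n) ≤ 2 * n *
      treeCount (fun T : SpanningTree n => T.1.edgeSet ∩ (M : Set (Sym2 (Fin n))) = {e}) := by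
  set N := Fintype.card (SpanningTree n)
  set A := M.erase e with hA
  have h1 := treeCount_avoid_le (A : Set (Sym2 (Fin n))) e (hM e he) (by simp [hA])
  have h2 : treeCount (fun T : SpanningTree n => Disjoint T.1.edgeSet (A : Set (Sym2 (Fin n))) ∧
      e ∈ T.1.edgeSet) =
      treeCount (fun T : SpanningTree n => T.1.edgeSet ∩ (M : Set (Sym2 (Fin n))) = {e}) := by
    congr 1
    funext T
    apply propext
    have hMe : (M : Set (Sym2 (Fin n))) = insert e (A : Set (Sym2 (Fin n))) := by
      rw [hA]; simp [he]
    rw [hMe]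
    constructor
    · rintro ⟨h, h'⟩
      rw [Set.inter_insert_of_mem h', h.inter_eq]; simp
    · intro h
      have h' : e ∈ T.1.edgeSet := ((Set.ext_iff.1 h e).2 rfl).1
      refine ⟨?_, h'⟩
      rw [Set.disjoint_left]
      intro f hf hfA
      have : f = e := (Set.ext_iff.1 h f).1 ⟨hf, Set.mem_insert_of_mem _ hfA⟩
      rw [this, hA] at hfA
      simp at hfA
  rw [h2] at h1
  have h3 : N ≤ treeCount (fun T : SpanningTree n => Disjoint T.1.edgeSet
      (A : Set (Sym2 (Fin n)))) +
      ∑ f ∈ A, treeCount (fun T : SpanningTree n => f ∈ T.1.edgeSet) := by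
    simp_rw [treeCount_eq_sum]
    rw [Finset.sum_comm, ← Finset.sum_add_distrib]
    have hN : N = ∑ T : SpanningTree n, 1 := by simp [N, Finset.card_univ]
    rw [hN]
    refine Finset.sum_le_sum fun T _ => ?_
    by_cases h : Disjoint T.1.edgeSet (A : Set (Sym2 (Fin n)))
    · simp [h]
    · have h' := h
      rw [Set.not_disjoint_iff] at h'
      obtain ⟨f, hf, hfA⟩ := h'
      rw [if_neg h, zero_add]
      have := Finset.single_le_sum (f := fun f => @ite ℕ (f ∈ T.1.edgeSet)
        (Classical.propDecidable _) 1 0) (fun _ _ => Nat.zero_le _) hfA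
      refine le_trans ?_ this
      exact (if_pos hf).ge
  have h4 : n * ∑ f ∈ A, treeCount (fun T : SpanningTree n => f ∈ T.1.edgeSet) ≤
      #A * (2 * N) := by
    rw [Finset.mul_sum]
    exact Finset.sum_le_card_nsmul _ _ _ fun f hf =>
      treeCount_mem_mul f (hM f (mem_of_mem_erase hf))
  have h5 : #A ≤ #M := card_le_card (erase_subset _ _)
  have hn : 0 < n := by
    have := card_pos.2 ⟨e, he⟩
    omega
  set a := treeCount (fun T : SpanningTree n => Disjoint T.1.edgeSet (A : Set (Sym2 (Fin n))))
  set b := ∑ f ∈ A, treeCount (fun T : SpanningTree n => f ∈ T.1.edgeSet)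
  have h6 : 2 * b ≤ N := by
    refine Nat.le_of_mul_le_mul_left ?_ hn
    calc n * (2 * b) = 2 * (n * b) := by ring
      _ ≤ 2 * (#A * (2 * N)) := by gcongr
      _ = (4 * #A) * N := by ring
      _ ≤ n * N := by gcongr; omega
  calc N ≤ 2 * a := by omega
    _ ≤ 2 * (n * _) := by gcongr
    _ = _ := by ring

lemma card_spanningTree_pos (hn : 0 < n) : 0 < Fintype.card (SpanningTree n) := by
  have : Nonempty (Fin n) := ⟨⟨0, hn⟩⟩
  obtain ⟨T, -, hT⟩ := (SimpleGraph.connected_top (V := Fin n)).exists_isTree_le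
  exact Fintype.card_pos_iff.2 ⟨⟨T, hT.1, hT.2⟩⟩

end Trees

section Value

open Finset
open scoped Classical

variable {n : ℕ}

/-- Average over a uniformly random spanning tree. -/
noncomputable def treeAvg (F : SpanningTree n → ℝ) : ℝ :=
  (∑ T, F T) / Fintype.card (SpanningTree n)

lemma treeAvg_mono {F F' : SpanningTree n → ℝ} (h : ∀ T, F T ≤ F' T) :
    treeAvg F ≤ treeAvg F' := by
  unfold treeAvg
  gcongr with T
  exact h T

lemma treeAvg_const_le {a : ℝ} (ha : 0 ≤ a) : treeAvg (fun _ : SpanningTree n => a) ≤ a := by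
  unfold treeAvg
  rw [Finset.sum_const, Finset.card_univ, nsmul_eq_mul, mul_comm, mul_div_assoc]
  exact mul_le_of_le_one_right ha (div_self_le_one _)

lemma treeAvg_add (F F' : SpanningTree n → ℝ) :
    treeAvg (fun T => F T + F' T) = treeAvg F + treeAvg F' := by
  unfold treeAvg
  rw [Finset.sum_add_distrib, add_div]

lemma treeAvg_const_mul (a : ℝ) (F : SpanningTree n → ℝ) :
    treeAvg (fun T => a * F T) = a * treeAvg F := by
  unfold treeAvg
  rw [← Finset.mul_sum, mul_div_assoc]

lemma treeAvg_sum {ι : Type*} (s : Finset ι) (F : ι → SpanningTree n → ℝ) :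
    treeAvg (fun T => ∑ i ∈ s, F i T) = ∑ i ∈ s, treeAvg (F i) := by
  unfold treeAvg
  rw [Finset.sum_comm, Finset.sum_div]

lemma treeAvg_indicator (p : SpanningTree n → Prop) [DecidablePred p] :
    treeAvg (fun T => if p T then 1 else 0) =
      (treeCount p : ℝ) / Fintype.card (SpanningTree n) := by
  unfold treeAvg
  rw [treeCount_eq_sum]
  push_cast
  congr!

/-- Add to `G` the edge claimed from `T` by the choice `c`. -/
def addEdge (G : SimpleGraph (Fin n)) (T : SpanningTree n) (c : Option (Sym2 (Fin n))) :
    SimpleGraph (Fin n) :=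
  G ⊔ match c with
  | none => ⊥
  | some e => SimpleGraph.fromEdgeSet ({e} ∩ T.1.edgeSet)

lemma le_addEdge (G : SimpleGraph (Fin n)) (T : SpanningTree n) (c : Option (Sym2 (Fin n))) :
    G ≤ addEdge G T c := le_sup_left

@[simp] lemma addEdge_none (G : SimpleGraph (Fin n)) (T : SpanningTree n) :
    addEdge G T none = G := sup_bot_eq _

lemma mem_edgeSet_addEdge_some {G : SimpleGraph (Fin n)} {T : SpanningTree n}
    {e f : Sym2 (Fin n)} (hf : f ∈ T.1.edgeSet) :
    e ∈ (addEdge G T (some f)).edgeSet ↔ e ∈ G.edgeSet ∨ e = f := by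
  have h := SimpleGraph.not_isDiag_of_mem_edgeSet _ hf
  simp only [addEdge, SimpleGraph.edgeSet_sup, SimpleGraph.edgeSet_fromEdgeSet, Set.mem_union,
    Set.mem_sdiff, Set.mem_inter_iff, Set.mem_singleton_iff]
  constructor
  · rintro (h | h)
    · exact .inl h
    · exact .inr h.1.1
  · rintro (h1 | rfl)
    · exact .inl h1
    · exact .inr ⟨⟨rfl, hf⟩, h⟩

/-- The minimal expected value of `φ` at the graph obtained after `t` more rounds started
from a given graph. -/
noncomputable def gameVal (φ : SimpleGraph (Fin n) → ℝ) : ℕ → SimpleGraph (Fin n) → ℝ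
  | 0, G => φ G
  | t + 1, G => treeAvg fun T => ⨅ c, gameVal φ t (addEdge G T c)

lemma ciInf_choice_le (f : Option (Sym2 (Fin n)) → ℝ) (c : Option (Sym2 (Fin n))) :
    ⨅ c, f c ≤ f c :=
  ciInf_le (Set.finite_range _).bddBelow c

lemma gameVal_mono_of_ge {φ ψ : SimpleGraph (Fin n) → ℝ} {G : SimpleGraph (Fin n)}
    (h : ∀ G', G ≤ G' → φ G' ≤ ψ G') (t : ℕ) : gameVal φ t G ≤ gameVal ψ t G := by
  induction t generalizing G with
  | zero => exact h G le_rfl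
  | succ t ih =>
    refine treeAvg_mono fun T => le_ciInf fun c => (ciInf_choice_le _ c).trans ?_
    exact ih fun G' hG' => h G' ((le_addEdge _ _ _).trans hG')

lemma gameVal_add (φ : SimpleGraph (Fin n) → ℝ) (s t : ℕ) (G : SimpleGraph (Fin n)) :
    gameVal φ (s + t) G = gameVal (gameVal φ t) s G := by
  induction s generalizing G with
  | zero => simp [gameVal]
  | succ s ih => rw [Nat.succ_add]; simp only [gameVal, ih]

lemma gameVal_nonneg {φ : SimpleGraph (Fin n) → ℝ} (h : ∀ G, 0 ≤ φ G) (t : ℕ)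
    (G : SimpleGraph (Fin n)) : 0 ≤ gameVal φ t G := by
  induction t generalizing G with
  | zero => exact h G
  | succ t ih =>
    exact div_nonneg (Finset.sum_nonneg fun T _ => le_ciInf fun c => ih _) (Nat.cast_nonneg _)

lemma gameVal_add_const_le (φ : SimpleGraph (Fin n) → ℝ) {a : ℝ} (ha : 0 ≤ a) (t : ℕ)
    (G : SimpleGraph (Fin n)) : gameVal (fun G => φ G + a) t G ≤ gameVal φ t G + a := by
  induction t generalizing G with
  | zero => exact le_rfl
  | succ t ih =>
    calc _ ≤ treeAvg fun T => (⨅ c, gameVal φ t (addEdge G T c)) + a := by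
          refine treeAvg_mono fun T => ?_
          rw [← sub_le_iff_le_add]
          refine le_ciInf fun c => ?_
          rw [sub_le_iff_le_add]
          exact (ciInf_choice_le _ c).trans (ih _)
      _ ≤ _ := by
          rw [treeAvg_add]
          exact add_le_add le_rfl (treeAvg_const_le ha)

lemma gameVal_le_potential {φ : SimpleGraph (Fin n) → ℝ} {Ψ : ℕ → SimpleGraph (Fin n) → ℝ}
    (h0 : ∀ G, φ G ≤ Ψ 0 G)
    (hs : ∀ t G, ∃ c : SpanningTree n → Option (Sym2 (Fin n)),
      treeAvg (fun T => Ψ t (addEdge G T (c T))) ≤ Ψ (t + 1) G) (t : ℕ)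
    (G : SimpleGraph (Fin n)) : gameVal φ t G ≤ Ψ t G := by
  induction t generalizing G with
  | zero => exact h0 G
  | succ t ih =>
    obtain ⟨c, hc⟩ := hs t G
    refine le_trans (treeAvg_mono fun T => ?_) hc
    exact (ciInf_choice_le _ (c T)).trans (ih _)

lemma gameVal_succ_le {φ : SimpleGraph (Fin n) → ℝ} (h : ∀ G, 0 ≤ φ G) (t : ℕ)
    (G : SimpleGraph (Fin n)) : gameVal φ (t + 1) G ≤ gameVal φ t G := by
  refine le_trans (treeAvg_mono fun T => ?_) (treeAvg_const_le (gameVal_nonneg h t G))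
  exact (ciInf_choice_le _ none).trans (by simp)

/-- From `G`, Builder can reach a graph in `𝒢` within `t` rounds, up to failure
probability `ε`. -/
def Reach (t : ℕ) (ε : ℝ) (G : SimpleGraph (Fin n)) (𝒢 : SimpleGraph (Fin n) → Prop) : Prop :=
  gameVal (fun G' => if 𝒢 G' then 0 else 1) t G ≤ ε

lemma Reach.of_mem {G : SimpleGraph (Fin n)} {𝒢 : SimpleGraph (Fin n) → Prop} (h : 𝒢 G) :
    Reach 0 0 G 𝒢 := by
  simp [Reach, gameVal, h]

lemma Reach.mono {s t : ℕ} {ε δ : ℝ} {G : SimpleGraph (Fin n)}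
    {𝒢 ℋ : SimpleGraph (Fin n) → Prop} (h : Reach s ε G 𝒢) (hst : s ≤ t) (hε : ε ≤ δ)
    (hG : ∀ G', G ≤ G' → 𝒢 G' → ℋ G') : Reach t δ G ℋ := by
  unfold Reach at *
  refine le_trans ?_ (h.trans hε)
  refine le_trans ?_ (gameVal_mono_of_ge (φ := fun G' => if ℋ G' then 0 else 1) ?_ s)
  · exact antitone_nat_of_succ_le (f := fun t => gameVal (fun G' => if ℋ G' then 0 else 1) t G)
      (fun t => gameVal_succ_le (fun G => by split_ifs <;> simp) t G) hst
  · intro G' hG'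
    by_cases h1 : 𝒢 G'
    · simp [h1, hG G' hG' h1]
    · simp only [h1, if_false]; split_ifs <;> simp

lemma gameVal_le_one {𝒢 : SimpleGraph (Fin n) → Prop} (t : ℕ) (G : SimpleGraph (Fin n)) :
    gameVal (fun G' => if 𝒢 G' then 0 else 1) t G ≤ 1 := by
  refine (antitone_nat_of_succ_le (f := fun t => gameVal (fun G' => if 𝒢 G' then 0 else 1) t G)
    (fun t => gameVal_succ_le (fun G => ?_) t G) (Nat.zero_le t)).trans ?_
  · split_ifs <;> simp
  · simp only [gameVal]; split_ifs <;> simp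

lemma Reach.trans {s t : ℕ} {ε δ : ℝ} {G : SimpleGraph (Fin n)}
    {𝒢 ℋ : SimpleGraph (Fin n) → Prop} (h : Reach s ε G 𝒢) (hδ : 0 ≤ δ)
    (hG : ∀ G', G ≤ G' → 𝒢 G' → Reach t δ G' ℋ) : Reach (s + t) (ε + δ) G ℋ := by
  unfold Reach at *
  rw [gameVal_add]
  calc _ ≤ gameVal (fun G' => (if 𝒢 G' then 0 else 1) + δ) s G := by
        refine gameVal_mono_of_ge (fun G' hG' => ?_) s
        by_cases h1 : 𝒢 G'
        · simpa [h1] using hG G' hG' h1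
        · simp only [h1, if_false]
          exact (gameVal_le_one t G').trans (by linarith)
    _ ≤ _ := (gameVal_add_const_le _ hδ _ _).trans (by linarith)

/-- An optimal choice. -/
noncomputable def bestChoice (φ : SimpleGraph (Fin n) → ℝ) (t : ℕ) (G : SimpleGraph (Fin n))
    (T : SpanningTree n) : Option (Sym2 (Fin n)) :=
  (exists_eq_ciInf_of_finite (f := fun c => gameVal φ t (addEdge G T c))).choose

lemma gameVal_bestChoice (φ : SimpleGraph (Fin n) → ℝ) (t : ℕ) (G : SimpleGraph (Fin n))
    (T : SpanningTree n) :
    gameVal φ t (addEdge G T (bestChoice φ t G T)) = ⨅ c, gameVal φ t (addEdge G T c) :=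
  (exists_eq_ciInf_of_finite (f := fun c => gameVal φ t (addEdge G T c))).choose_spec

/-- The graph obtained by optimal play with horizon `N`. -/
noncomputable def optimalRun (φ : SimpleGraph (Fin n) → ℝ) :
    ℕ → SimpleGraph (Fin n) → List (SpanningTree n) → SimpleGraph (Fin n)
  | _, G, [] => G
  | N, G, T :: rest =>
    optimalRun φ (N - 1) (addEdge G T (bestChoice φ (N - 1) G T)) rest

/-- The strategy playing optimally with horizon `N`. -/
noncomputable def optimalStrategy (φ : SimpleGraph (Fin n) → ℝ) (N : ℕ) : TreeStrategy n :=
  fun hist T => bestChoice φ (N - hist.length - 1) (optimalRun φ N ⊥ hist) T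

lemma optimalRun_concat (φ : SimpleGraph (Fin n) → ℝ) (N : ℕ) (G : SimpleGraph (Fin n))
    (l : List (SpanningTree n)) (T : SpanningTree n) :
    optimalRun φ N G (l ++ [T]) = addEdge (optimalRun φ N G l) T
      (bestChoice φ (N - l.length - 1) (optimalRun φ N G l) T) := by
  induction l generalizing N G with
  | nil => simp [optimalRun]
  | cons S l ih =>
    simp only [List.cons_append, optimalRun, ih, List.length_cons]
    congr 2
    omega

lemma optimalRun_sup_treeBuildAux (φ : SimpleGraph (Fin n) → ℝ) (N : ℕ)
    (hist rest : List (SpanningTree n)) :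
    optimalRun φ N ⊥ hist ⊔ treeBuildAux (optimalStrategy φ N) hist rest =
      optimalRun φ N ⊥ (hist ++ rest) := by
  induction rest generalizing hist with
  | nil => simp [treeBuildAux]
  | cons T rest ih =>
    have h := ih (hist ++ [T])
    rw [List.append_assoc, List.singleton_append] at h
    rw [← h, treeBuildAux, ← sup_assoc, optimalRun_concat]
    rfl

lemma treeBuild_optimalStrategy (φ : SimpleGraph (Fin n) → ℝ) (N : ℕ)
    (l : List (SpanningTree n)) :
    treeBuild (optimalStrategy φ N) l = optimalRun φ N ⊥ l := by
  have h := optimalRun_sup_treeBuildAux φ N [] l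
  simpa [optimalRun, treeBuild] using h

lemma sum_optimalRun (φ : SimpleGraph (Fin n) → ℝ) (hn : 0 < n) (t : ℕ)
    (G : SimpleGraph (Fin n)) :
    ∑ ω : Fin t → SpanningTree n, φ (optimalRun φ t G (List.ofFn ω)) =
      (Fintype.card (SpanningTree n) : ℝ) ^ t * gameVal φ t G := by
  induction t generalizing G with
  | zero => simp [optimalRun, gameVal]
  | succ t ih =>
    have hc : (Fintype.card (SpanningTree n) : ℝ) ≠ 0 := by
      have := card_spanningTree_pos hn
      positivity
    rw [← (Fin.consEquiv fun _ => SpanningTree n).sum_comp, Fintype.sum_prod_type]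
    have h1 : ∀ (T : SpanningTree n) (ω : Fin t → SpanningTree n),
        φ (optimalRun φ (t + 1) G
          (List.ofFn ((Fin.consEquiv fun _ => SpanningTree n) (T, ω)))) =
        φ (optimalRun φ t (addEdge G T (bestChoice φ t G T)) (List.ofFn ω)) := by
      intro T ω
      have : List.ofFn ((Fin.consEquiv fun _ => SpanningTree n) (T, ω)) = T :: List.ofFn ω := by
        rw [List.ofFn_succ]; rfl
      rw [this]
      rfl
    simp only [h1, ih, gameVal_bestChoice, gameVal, treeAvg]
    rw [← Finset.mul_sum, pow_succ]
    field_simp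

lemma Reach.exists_strategy {t : ℕ} {ε : ℝ} {H : SimpleGraph (Fin n)} (hn : 0 < n)
    (h : Reach t ε ⊥ fun G => ContainsCopy G H) :
    ∃ σ : TreeStrategy n, 1 - ε ≤ treeProb n t σ H := by
  set φ : SimpleGraph (Fin n) → ℝ := fun G => if ContainsCopy G H then 0 else 1 with hφ
  refine ⟨optimalStrategy φ t, ?_⟩
  have hs := sum_optimalRun φ hn t ⊥
  have hc : (0 : ℝ) < Fintype.card (SpanningTree n) := by
    have := card_spanningTree_pos hn
    positivity
  have hcard : (Nat.card {ω : Fin t → SpanningTree n //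
      ContainsCopy (treeBuild (optimalStrategy φ t) (List.ofFn ω)) H} : ℝ) =
      (Fintype.card (SpanningTree n) : ℝ) ^ t -
        ∑ ω : Fin t → SpanningTree n, φ (optimalRun φ t ⊥ (List.ofFn ω)) := by
    rw [Nat.card_eq_fintype_card, Fintype.card_subtype, eq_sub_iff_add_eq]
    simp only [hφ, treeBuild_optimalStrategy]
    have h1 : (Fintype.card (SpanningTree n) : ℝ) ^ t =
        ∑ ω : Fin t → SpanningTree n, 1 := by simp [Finset.card_univ]
    rw [h1, Finset.card_filter]
    push_cast
    rw [← Finset.sum_add_distrib]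
    refine Finset.sum_congr rfl fun ω _ => ?_
    split_ifs <;> simp
  unfold treeProb
  rw [hcard, hs, Nat.card_eq_fintype_card, le_div_iff₀ (by positivity)]
  have : gameVal φ t ⊥ ≤ ε := h
  have h2 := mul_le_mul_of_nonneg_left this (pow_pos hc t).le
  linarith

lemma treeProb_le_one {t : ℕ} (σ : TreeStrategy n) (H : SimpleGraph (Fin n)) :
    treeProb n t σ H ≤ 1 := by
  unfold treeProb
  refine div_le_one_of_le₀ ?_ (by positivity)
  have : Nat.card (Fin t → SpanningTree n) = Nat.card (SpanningTree n) ^ t := by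
    simp [Nat.card_eq_fintype_card]
  rw [← Nat.cast_pow, ← this]
  exact_mod_cast Finite.card_subtype_le _

end Value

section Sprinkle

open Finset
open scoped Classical

variable {n : ℕ}

lemma disjoint_addEdge {F : Finset (Sym2 (Fin n))} {G : SimpleGraph (Fin n)}
    {T : SpanningTree n} {c : Option (Sym2 (Fin n))}
    (h : Disjoint (F : Set (Sym2 (Fin n))) (addEdge G T c).edgeSet) :
    Disjoint (F : Set (Sym2 (Fin n))) G.edgeSet :=
  h.mono_right (SimpleGraph.edgeSet_mono (le_addEdge G T c))

/-- Claim the unique edge of `M` in the offered tree, if there is exactly one. -/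
noncomputable def uniqueChoice (M : Finset (Sym2 (Fin n))) (T : SpanningTree n) :
    Option (Sym2 (Fin n)) :=
  if h : ∃ e, T.1.edgeSet ∩ (M : Set (Sym2 (Fin n))) = {e} then some h.choose else none

lemma uniqueChoice_eq {M : Finset (Sym2 (Fin n))} {T : SpanningTree n} {e : Sym2 (Fin n)}
    (h : T.1.edgeSet ∩ (M : Set (Sym2 (Fin n))) = {e}) : uniqueChoice M T = some e := by
  have h' : ∃ e, T.1.edgeSet ∩ (M : Set (Sym2 (Fin n))) = {e} := ⟨e, h⟩
  rw [uniqueChoice, dif_pos h']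
  exact congrArg some (Set.singleton_injective (h.symm.trans h'.choose_spec)).symm

lemma treeAvg_unhit_le (M : Finset (Sym2 (Fin n))) (hM : ∀ e ∈ M, ¬ e.IsDiag)
    (hc : 4 * #M ≤ n) (F : Finset (Sym2 (Fin n))) (G : SimpleGraph (Fin n)) :
    treeAvg (fun T => if Disjoint (F : Set (Sym2 (Fin n)))
      (addEdge G T (uniqueChoice M T)).edgeSet then 1 else 0) ≤
      Real.exp (-(#(F ∩ M) : ℝ) / (2 * n)) *
        if Disjoint (F : Set (Sym2 (Fin n))) G.edgeSet then 1 else 0 := by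
  by_cases hF : Disjoint (F : Set (Sym2 (Fin n))) G.edgeSet
  swap
  · rw [if_neg hF, mul_zero]
    refine (treeAvg_mono fun T => ?_).trans (treeAvg_const_le le_rfl)
    rw [if_neg fun h => hF (disjoint_addEdge h)]
  rw [if_pos hF, mul_one]
  have h1 : ∀ T : SpanningTree n, (if Disjoint (F : Set (Sym2 (Fin n)))
      (addEdge G T (uniqueChoice M T)).edgeSet then (1 : ℝ) else 0) +
      ∑ e ∈ F ∩ M, (if T.1.edgeSet ∩ (M : Set (Sym2 (Fin n))) = {e} then (1 : ℝ) else 0) ≤ 1 := by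
    intro T
    by_cases h : ∃ e ∈ F ∩ M, T.1.edgeSet ∩ (M : Set (Sym2 (Fin n))) = {e}
    · obtain ⟨e, he, heT⟩ := h
      rw [mem_inter] at he
      have heT' : e ∈ T.1.edgeSet := ((Set.ext_iff.1 heT e).2 rfl).1
      rw [if_neg, zero_add]
      · rw [Finset.sum_eq_single_of_mem e (mem_inter.2 he)]
        · split_ifs <;> simp
        · intro f _ hfe
          rw [if_neg]
          rw [heT]
          intro h
          exact hfe (Set.singleton_injective h).symm
      · rw [uniqueChoice_eq heT, Set.not_disjoint_iff]
        exact ⟨e, he.1, (mem_edgeSet_addEdge_some heT').2 (.inr rfl)⟩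
    · rw [Finset.sum_eq_zero fun e he => if_neg fun h' => h ⟨e, he, h'⟩, add_zero]
      split_ifs <;> simp
  have h2 := (treeAvg_mono h1).trans (treeAvg_const_le zero_le_one)
  rw [treeAvg_add, treeAvg_sum] at h2
  have h3 : (#(F ∩ M) : ℝ) * (1 / (2 * n)) ≤ ∑ e ∈ F ∩ M, treeAvg (fun T : SpanningTree n =>
      if T.1.edgeSet ∩ (M : Set (Sym2 (Fin n))) = {e} then (1 : ℝ) else 0) := by
    rw [← nsmul_eq_mul]
    refine Finset.card_nsmul_le_sum _ _ _ fun e he => ?_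
    rw [mem_inter] at he
    have hn : 0 < n := by
      have := card_pos.2 ⟨e, he.2⟩
      omega
    have h4 := card_le_treeCount_inter_eq M hM hc e he.2
    have h5 := card_spanningTree_pos hn
    rw [treeAvg_indicator (fun T : SpanningTree n =>
      T.1.edgeSet ∩ (M : Set (Sym2 (Fin n))) = {e}), div_le_div_iff₀ (by positivity) (by positivity), one_mul]
    have h6 : (Fintype.card (SpanningTree n) : ℝ) ≤ 2 * n * treeCount (fun T : SpanningTree n =>
      T.1.edgeSet ∩ (M : Set (Sym2 (Fin n))) = {e}) := by exact_mod_cast h4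
    linarith
  have h4 := Real.add_one_le_exp (-(#(F ∩ M) : ℝ) / (2 * n))
  have h5 : (#(F ∩ M) : ℝ) * (1 / (2 * n)) = (#(F ∩ M) : ℝ) / (2 * n) := by ring
  have h6 : -(#(F ∩ M) : ℝ) / (2 * n) = -((#(F ∩ M) : ℝ) / (2 * n)) := by ring
  rw [h6] at h4 ⊢
  linarith

lemma gameVal_unhit_le (M : Finset (Sym2 (Fin n))) (hM : ∀ e ∈ M, ¬ e.IsDiag)
    (hc : 4 * #M ≤ n) (ℱ : Finset (Finset (Sym2 (Fin n)))) (w : Finset (Sym2 (Fin n)) → ℝ)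
    (hw : ∀ F, 0 ≤ w F) (t : ℕ) (G : SimpleGraph (Fin n)) :
    gameVal (fun G => ∑ F ∈ ℱ, w F *
      if Disjoint (F : Set (Sym2 (Fin n))) G.edgeSet then 1 else 0) t G ≤
      ∑ F ∈ ℱ, w F * Real.exp (-(#(F ∩ M) : ℝ) / (2 * n)) ^ t *
        if Disjoint (F : Set (Sym2 (Fin n))) G.edgeSet then 1 else 0 := by
  refine gameVal_le_potential (Ψ := fun t G => ∑ F ∈ ℱ, w F *
    Real.exp (-(#(F ∩ M) : ℝ) / (2 * n)) ^ t *
        if Disjoint (F : Set (Sym2 (Fin n))) G.edgeSet then 1 else 0) (fun G => by simp)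
    (fun t G => ⟨uniqueChoice M, ?_⟩) t G
  rw [treeAvg_sum]
  refine Finset.sum_le_sum fun F _ => ?_
  rw [treeAvg_const_mul, pow_succ, ← mul_assoc, mul_assoc _ (Real.exp _)]
  exact mul_le_mul_of_nonneg_left (treeAvg_unhit_le M hM hc F G)
    (mul_nonneg (hw F) (by positivity))

lemma gameVal_unhit_chunks_le (P : ℕ → Finset (Sym2 (Fin n)))
    (hP : ∀ i, ∀ e ∈ P i, ¬ e.IsDiag)
    (hc : ∀ i, 4 * #(P i) ≤ n) (ℱ : Finset (Finset (Sym2 (Fin n))))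
    (w : Finset (Sym2 (Fin n)) → ℝ) (hw : ∀ F, 0 ≤ w F) (t c : ℕ) (G : SimpleGraph (Fin n)) :
    gameVal (fun G => ∑ F ∈ ℱ, w F *
      if Disjoint (F : Set (Sym2 (Fin n))) G.edgeSet then 1 else 0) (c * t) G ≤
      ∑ F ∈ ℱ, w F * (∏ i ∈ range c, Real.exp (-(#(F ∩ P i) : ℝ) / (2 * n)) ^ t) *
        if Disjoint (F : Set (Sym2 (Fin n))) G.edgeSet then 1 else 0 := by
  induction c generalizing G with
  | zero => simp [gameVal]
  | succ c ih =>
    rw [Nat.succ_mul, add_comm, gameVal_add]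
    refine (gameVal_mono_of_ge (fun G' _ => ih G') t).trans ?_
    refine (gameVal_unhit_le (P c) (hP c) (hc c) ℱ _
      (fun F => mul_nonneg (hw F) (Finset.prod_nonneg fun i _ => by positivity)) t G).trans ?_
    refine le_of_eq (Finset.sum_congr rfl fun F _ => ?_)
    rw [prod_range_succ]
    ring

lemma exists_chunks {α : Type*} [DecidableEq α] (m c : ℕ) (M : Finset α) (h : #M ≤ c * m) :
    ∃ P : ℕ → Finset α, (∀ i, P i ⊆ M) ∧ (∀ i, #(P i) ≤ m) ∧ M ⊆ (range c).biUnion P := by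
  induction c generalizing M with
  | zero =>
    refine ⟨fun _ => ∅, by simp, by simp, ?_⟩
    have : M = ∅ := by simpa using h
    simp [this]
  | succ c ih =>
    obtain ⟨A, hA, hAc⟩ := exists_subset_card_eq (min_le_left #M m)
    obtain ⟨P, h1, h2, h3⟩ := ih (M \ A) (by
      rw [card_sdiff_of_subset hA, hAc]
      rw [Nat.succ_mul] at h
      omega)
    refine ⟨fun i => if i = c then A else P i, fun i => ?_, fun i => ?_, fun e he => ?_⟩
    · dsimp only; split_ifs
      exacts [hA, (h1 i).trans sdiff_subset]
    · dsimp only; split_ifs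
      exacts [hAc.trans_le (min_le_right _ _), h2 i]
    · by_cases heA : e ∈ A
      · rw [mem_biUnion]
        exact ⟨c, by simp, by simpa using heA⟩
      · have := h3 (mem_sdiff.2 ⟨he, heA⟩)
        rw [mem_biUnion] at this ⊢
        obtain ⟨i, hi, hei⟩ := this
        rw [mem_range] at hi
        exact ⟨i, by simp; omega, by simpa [hi.ne] using hei⟩

/-- Playing on the edges of `M` in chunks of size at most `n/4`, Builder hits all members of a
family of subsets of `M`. -/
lemma reach_hit (M : Finset (Sym2 (Fin n))) (hM : ∀ e ∈ M, ¬ e.IsDiag) (c : ℕ)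
    (hc : #M ≤ c * (n / 4)) (ℱ : Finset (Finset (Sym2 (Fin n)))) (hℱ : ∀ F ∈ ℱ, F ⊆ M)
    (t : ℕ) (G : SimpleGraph (Fin n)) :
    Reach (c * t) (∑ F ∈ ℱ, Real.exp (-(t : ℝ) / (2 * n)) ^ #F) G
      fun G' => ∀ F ∈ ℱ, ¬ Disjoint (F : Set (Sym2 (Fin n))) G'.edgeSet := by
  obtain ⟨P, h1, h2, h3⟩ := exists_chunks (n / 4) c M hc
  unfold Reach
  refine (gameVal_mono_of_ge (ψ := fun G => ∑ F ∈ ℱ, 1 *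
    if Disjoint (F : Set (Sym2 (Fin n))) G.edgeSet then 1 else 0) (fun G' _ => ?_) _).trans
      ((gameVal_unhit_chunks_le P (fun i e he => hM e (h1 i he)) (fun i => ?_) ℱ _
        (fun _ => zero_le_one) t c G).trans ?_)
  · split_ifs with h
    · exact Finset.sum_nonneg fun F _ => by split_ifs <;> simp
    · push Not at h
      obtain ⟨F, hF, hd⟩ := h
      refine le_trans ?_ (Finset.single_le_sum (f := fun F : Finset (Sym2 (Fin n)) => (1 : ℝ) *
        if Disjoint (F : Set (Sym2 (Fin n))) G'.edgeSet then 1 else 0)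
        (fun F _ => by split_ifs <;> simp) hF)
      simp [hd]
  · have := h2 i; omega
  · refine Finset.sum_le_sum fun F hF => ?_
    have h4 : #F ≤ ∑ i ∈ range c, #(F ∩ P i) := by
      refine le_trans (card_le_card ?_) card_biUnion_le
      intro e he
      have := h3 (hℱ F hF he)
      rw [mem_biUnion] at this ⊢
      obtain ⟨i, hi, hei⟩ := this
      exact ⟨i, hi, mem_inter.2 ⟨he, hei⟩⟩
    have h5 : ∏ i ∈ range c, Real.exp (-(#(F ∩ P i) : ℝ) / (2 * n)) ^ t ≤
        Real.exp (-(t : ℝ) / (2 * n)) ^ #F := by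
      simp_rw [← Real.exp_nat_mul]
      rw [← Real.exp_sum, Real.exp_le_exp, ← Finset.mul_sum, ← Finset.sum_div,
        Finset.sum_neg_distrib]
      have h6 : (#F : ℝ) ≤ ∑ i ∈ range c, (#(F ∩ P i) : ℝ) := by exact_mod_cast h4
      have h7 : 0 ≤ (t : ℝ) / (2 * n) := by positivity
      calc _ = -((t : ℝ) / (2 * n) * ∑ i ∈ range c, (#(F ∩ P i) : ℝ)) := by ring
        _ ≤ -((t : ℝ) / (2 * n) * #F) := by gcongr
        _ = _ := by ring
    rw [one_mul]
    refine le_trans ?_ h5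
    refine mul_le_of_le_one_right (Finset.prod_nonneg fun i _ => by positivity) ?_
    split_ifs <;> simp

/-- The edges of `E` that are missing in `G`. -/
noncomputable def missing (E : Finset (Sym2 (Fin n))) (G : SimpleGraph (Fin n)) :
    Finset (Sym2 (Fin n)) := {e ∈ E | e ∉ G.edgeSet}

lemma mem_missing {E : Finset (Sym2 (Fin n))} {G : SimpleGraph (Fin n)} {e : Sym2 (Fin n)} :
    e ∈ missing E G ↔ e ∈ E ∧ e ∉ G.edgeSet := by simp [missing]

lemma missing_subset (E : Finset (Sym2 (Fin n))) (G : SimpleGraph (Fin n)) :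
    missing E G ⊆ E := filter_subset _ _

lemma missing_anti (E : Finset (Sym2 (Fin n))) {G G' : SimpleGraph (Fin n)} (h : G ≤ G') :
    missing E G' ⊆ missing E G := by
  intro e he
  rw [mem_missing] at he ⊢
  exact ⟨he.1, fun h' => he.2 (SimpleGraph.edgeSet_mono h h')⟩

lemma reach_group {ι : Type*} (I : Finset ι) (E : ι → Finset (Sym2 (Fin n)))
    (M : Finset (Sym2 (Fin n))) (hM : ∀ e ∈ M, ¬ e.IsDiag) (c : ℕ)
    (hc : #M ≤ c * (n / 4)) (hE : ∀ u ∈ I, E u ⊆ M) (m : ℕ) (hm : ∀ u ∈ I, #(E u) ≤ m)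
    (h x t : ℕ) (G : SimpleGraph (Fin n)) :
    Reach (c * t) (((#I).choose (x + 1) : ℝ) * ((x + 1) * m).choose ((x + 1) * h) *
        Real.exp (-(t : ℝ) / (2 * n)) ^ ((x + 1) * h)) G
      fun G' => ∀ S ⊆ I, #S = x + 1 → (S : Set ι).PairwiseDisjoint E →
        ∃ u ∈ S, #(missing (E u) G') < h := by
  set ℱ : Finset (Finset (Sym2 (Fin n))) :=
    (powersetCard (x + 1) I).biUnion fun S => powersetCard ((x + 1) * h) (S.biUnion E) with hℱ
  have hcard : ∀ F ∈ ℱ, #F = (x + 1) * h := by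
    intro F hF
    rw [hℱ, mem_biUnion] at hF
    obtain ⟨S, -, hF⟩ := hF
    exact (mem_powersetCard.1 hF).2
  refine (reach_hit M hM c hc ℱ ?_ t G).mono le_rfl ?_ ?_
  · intro F hF
    rw [hℱ, mem_biUnion] at hF
    obtain ⟨S, hS, hF⟩ := hF
    refine (mem_powersetCard.1 hF).1.trans (biUnion_subset.2 fun u hu => ?_)
    exact hE u ((mem_powersetCard.1 hS).1 hu)
  · rw [Finset.sum_congr rfl fun F hF => by rw [hcard F hF], Finset.sum_const, nsmul_eq_mul]
    refine mul_le_mul_of_nonneg_right ?_ (by positivity)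
    have : #ℱ ≤ (#I).choose (x + 1) * ((x + 1) * m).choose ((x + 1) * h) := by
      rw [← card_powersetCard]
      refine card_biUnion_le_card_mul _ _ _ fun S hS => ?_
      rw [card_powersetCard]
      refine Nat.choose_le_choose _ ?_
      have hS' := mem_powersetCard.1 hS
      rw [← hS'.2]
      exact card_biUnion_le_card_mul _ _ _ fun u hu => hm u (hS'.1 hu)
    exact_mod_cast this
  · intro G' _ hG' S hS hSc hd
    by_contra hcon
    push Not at hcon
    have h1 : (x + 1) * h ≤ #(S.biUnion fun u => missing (E u) G') := by
      rw [card_biUnion, ← hSc]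
      · exact Finset.card_nsmul_le_sum _ _ _ hcon
      · intro u hu v hv huv
        exact (hd hu hv huv).mono (missing_subset _ _) (missing_subset _ _)
    obtain ⟨F, hF, hFc⟩ := exists_subset_card_eq h1
    refine hG' F ?_ ?_
    · rw [hℱ, mem_biUnion]
      refine ⟨S, mem_powersetCard.2 ⟨hS, hSc⟩, mem_powersetCard.2 ⟨hF.trans ?_, hFc⟩⟩
      exact biUnion_mono fun u _ => missing_subset _ _
    · rw [Set.disjoint_left]
      intro e he
      obtain ⟨u, _, hu⟩ := mem_biUnion.1 (hF he)
      exact (mem_missing.1 hu).2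

/-- Greedy phase: claiming a missing edge whenever possible, few edges remain missing. -/
lemma reach_greedy (E : Finset (Sym2 (Fin n))) (hE : ∀ e ∈ E, ¬ e.IsDiag) (hn : 0 < n)
    (B t : ℕ) (G : SimpleGraph (Fin n)) :
    Reach t (Real.exp (B * #(missing E G) - B * B * n - (B - 1) * t)) G
      fun G' => #(missing E G') ≤ B * n := by
  have key : Reach t (if #(missing E G) ≤ B * n then 0 else
      Real.exp (B * #(missing E G) - B * B * n - (B - 1) * t)) G
      fun G' => #(missing E G') ≤ B * n := by
    refine gameVal_le_potential (Ψ := fun t G => if #(missing E G) ≤ B * n then 0 else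
      Real.exp (B * #(missing E G) - B * B * n - (B - 1) * t)) (fun G => ?_)
      (fun t G => ?_) t G
    · split_ifs with h
      · exact le_rfl
      · rw [← Real.exp_zero, Real.exp_le_exp]
        have h1 : (B * n : ℝ) ≤ #(missing E G) := by
          push Not at h
          exact_mod_cast h.le
        have h2 : 0 ≤ (B : ℝ) := by positivity
        simp only [Nat.cast_zero, mul_zero, sub_zero]
        nlinarith
    · by_cases hG : #(missing E G) ≤ B * n
      · refine ⟨fun _ => none, ?_⟩
        simp only [addEdge_none, if_pos hG]
        exact treeAvg_const_le le_rfl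
      rw [if_neg hG]
      set A := missing E G with hA
      let ch : SpanningTree n → Option (Sym2 (Fin n)) := fun T =>
        if h : ∃ e ∈ A, e ∈ T.1.edgeSet then some h.choose else none
      refine ⟨ch, ?_⟩
      set R := Real.exp (B * #A - B * B * n - (B - 1) * t) with hR
      have hpt : ∀ T : SpanningTree n, (if #(missing E (addEdge G T (ch T))) ≤ B * n then 0 else
          Real.exp (B * #(missing E (addEdge G T (ch T))) - B * B * n - (B - 1) * t)) ≤
          R * Real.exp (-B) + R * (if Disjoint T.1.edgeSet (A : Set (Sym2 (Fin n))) then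
            1 else 0) := by
        intro T
        by_cases h : ∃ e ∈ A, e ∈ T.1.edgeSet
        · have hch : ch T = some h.choose := dif_pos h
          have hm : #(missing E (addEdge G T (ch T))) + 1 ≤ #A := by
            have h1 := h.choose_spec
            refine card_lt_card ⟨missing_anti E (le_addEdge _ _ _), fun hcon => ?_⟩
            have := (mem_missing.1 (hcon h1.1)).2
            rw [hch] at this
            exact this ((mem_edgeSet_addEdge_some h1.2).2 (.inr rfl))
          have h2 : 0 ≤ R * (if Disjoint T.1.edgeSet (A : Set (Sym2 (Fin n))) then
            1 else 0) := by split_ifs <;> positivity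
          refine le_trans ?_ (le_add_of_nonneg_right h2)
          split_ifs
          · positivity
          · rw [hR, ← Real.exp_add, Real.exp_le_exp]
            have : (#(missing E (addEdge G T (ch T))) : ℝ) + 1 ≤ #A := by exact_mod_cast hm
            have hB : (0 : ℝ) ≤ B := by positivity
            nlinarith
        · have hch : ch T = none := dif_neg h
          have hd : Disjoint T.1.edgeSet (A : Set (Sym2 (Fin n))) := by
            rw [Set.disjoint_left]
            exact fun e he he' => h ⟨e, he', he⟩
          rw [hch, addEdge_none, if_neg hG, if_pos hd, mul_one]
          have : 0 ≤ R * Real.exp (-B) := by positivity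
          linarith
      refine (treeAvg_mono hpt).trans ?_
      rw [treeAvg_add, treeAvg_const_mul R (fun T : SpanningTree n =>
        if Disjoint T.1.edgeSet (A : Set (Sym2 (Fin n))) then 1 else 0),
        treeAvg_indicator (fun T : SpanningTree n =>
          Disjoint T.1.edgeSet (A : Set (Sym2 (Fin n))))]
      have hav := treeCount_avoid_le_exp A fun e he => hE e (missing_subset _ _ he)
      have hN := card_spanningTree_pos hn
      have h3 : (treeCount (fun T : SpanningTree n => Disjoint T.1.edgeSet
          (A : Set (Sym2 (Fin n)))) : ℝ) / Fintype.card (SpanningTree n) ≤ Real.exp (-B) := by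
        rw [div_le_iff₀ (by positivity)]
        refine hav.trans (mul_le_mul_of_nonneg_right ?_ (by positivity))
        rw [Real.exp_le_exp, neg_div, neg_le_neg_iff, le_div_iff₀ (by positivity)]
        push Not at hG
        exact_mod_cast hG.le
      have h4 : treeAvg (fun _ : SpanningTree n => R * Real.exp (-B)) ≤ R * Real.exp (-B) :=
        treeAvg_const_le (by positivity)
      have h5 : (2 : ℝ) ≤ Real.exp 1 := by
        have := Real.add_one_le_exp (1 : ℝ); linarith
      calc _ ≤ R * Real.exp (-B) + R * Real.exp (-B) :=
            add_le_add h4 (mul_le_mul_of_nonneg_left h3 (by positivity))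
        _ = R * Real.exp (-B) * 2 := by ring
        _ ≤ R * Real.exp (-B) * Real.exp 1 := by gcongr
        _ = _ := by
          rw [hR, ← Real.exp_add, ← Real.exp_add]
          congr 1
          push_cast
          ring
  refine key.mono le_rfl ?_ fun _ _ h => h
  split_ifs
  · positivity
  · exact le_rfl

end Sprinkle

section Colouring

open Finset
open scoped Classical

lemma exists_colouring {α : Type*} (R : α → α → Prop) (hR : ∀ a b, R a b → R b a) (c : ℕ)
    (U : Finset α) (hU : ∀ u ∈ U, ∃ N : Finset α, #N < c ∧ ∀ v ∈ U, v ≠ u → R u v → v ∈ N) :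
    ∃ f : α → ℕ, (∀ u ∈ U, f u < c) ∧ ∀ u ∈ U, ∀ v ∈ U, u ≠ v → R u v → f u ≠ f v := by
  induction U using Finset.induction_on with
  | empty => exact ⟨fun _ => 0, by simp, by simp⟩
  | insert a U ha ih =>
    obtain ⟨f, h1, h2⟩ := ih fun u hu => by
      obtain ⟨N, hN, hN'⟩ := hU u (mem_insert_of_mem hu)
      exact ⟨N, hN, fun v hv => hN' v (mem_insert_of_mem hv)⟩
    obtain ⟨N, hN, hN'⟩ := hU a (mem_insert_self _ _)
    have hcard : #(({v ∈ U | R a v} : Finset α).image f) < #(range c) := by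
      rw [card_range]
      refine lt_of_le_of_lt (card_image_le.trans (card_le_card ?_)) hN
      intro v hv
      rw [mem_filter] at hv
      exact hN' v (mem_insert_of_mem hv.1) (fun h => ha (h ▸ hv.1)) hv.2
    obtain ⟨y, hy, hyn⟩ := exists_mem_notMem_of_card_lt_card hcard
    have hy' : ∀ v ∈ U, R a v → f v ≠ y := fun v hv hav h =>
      hyn (mem_image.2 ⟨v, mem_filter.2 ⟨hv, hav⟩, h⟩)
    have hne : ∀ v ∈ U, v ≠ a := fun v hv h => ha (h ▸ hv)
    refine ⟨Function.update f a y, fun u hu => ?_, fun u hu v hv huv hRuv => ?_⟩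
    · rcases mem_insert.1 hu with rfl | hu
      · simpa using hy
      · simpa [Function.update_of_ne (hne u hu)] using h1 u hu
    · rcases mem_insert.1 hu with hua | hu' <;> rcases mem_insert.1 hv with hva | hv'
      · exact absurd (hua.trans hva.symm) huv
      · subst hua
        rw [Function.update_self, Function.update_of_ne (hne v hv')]
        exact (hy' v hv' hRuv).symm
      · subst hva
        rw [Function.update_self, Function.update_of_ne (hne u hu')]
        exact hy' u hu' (hR _ _ hRuv)
      · rw [Function.update_of_ne (hne u hu'), Function.update_of_ne (hne v hv')]
        exact h2 u hu' v hv' huv hRuv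

lemma exists_independent {α : Type*} (R : α → α → Prop) (hR : ∀ a b, R a b → R b a) (c : ℕ)
    (U : Finset α) (hU : ∀ u ∈ U, ∃ N : Finset α, #N < c ∧ ∀ v ∈ U, v ≠ u → R u v → v ∈ N) :
    ∃ J ⊆ U, #U ≤ c * #J ∧ ∀ u ∈ J, ∀ v ∈ J, u ≠ v → ¬ R u v := by
  obtain ⟨f, h1, h2⟩ := exists_colouring R hR c U hU
  by_contra hcon
  push Not at hcon
  have hlt : ∀ y ∈ range c, ¬ #U ≤ c * #{u ∈ U | f u = y} := by
    intro y _ h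
    obtain ⟨u, hu, v, hv, huv, hRuv⟩ := hcon _ (filter_subset (fun u => f u = y) U) h
    rw [mem_filter] at hu hv
    exact h2 u hu.1 v hv.1 huv hRuv (hu.2.trans hv.2.symm)
  rcases Nat.eq_zero_or_pos c with rfl | hc
  · have : U = ∅ := eq_empty_of_forall_notMem fun u hu => by simpa using h1 u hu
    obtain ⟨u, hu, -⟩ := hcon ∅ (empty_subset _) (by simp [this])
    simp at hu
  have hsum : #U = ∑ y ∈ range c, #{u ∈ U | f u = y} :=
    card_eq_sum_card_fiberwise fun u hu => by simpa using h1 u hu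
  have : ∑ y ∈ range c, c * #{u ∈ U | f u = y} < ∑ y ∈ range c, #U := by
    refine sum_lt_sum_of_nonempty (nonempty_range_iff.2 hc.ne') fun y hy => ?_
    exact not_le.1 (hlt y hy)
  rw [← mul_sum, ← hsum, sum_const, card_range, smul_eq_mul] at this
  exact lt_irrefl _ this

end Colouring

section Covers

open Finset
open scoped Classical

variable {n : ℕ}

/-- The neighbours of `v`. -/
noncomputable def nbrs (H : SimpleGraph (Fin n)) (v : Fin n) : Finset (Fin n) :=
  {y | H.Adj v y}

@[simp] lemma mem_nbrs {H : SimpleGraph (Fin n)} {v y : Fin n} : y ∈ nbrs H v ↔ H.Adj v y := by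
  simp [nbrs]

/-- Some injection maps all edges of `H` not meeting `U` to edges of `G`. -/
def CopyOff (H : SimpleGraph (Fin n)) (U : Finset (Fin n)) (G : SimpleGraph (Fin n)) : Prop :=
  ∃ φ : Fin n → Fin n, Function.Injective φ ∧
    ∀ x y, H.Adj x y → x ∉ U → y ∉ U → G.Adj (φ x) (φ y)

lemma CopyOff.mono {H G G' : SimpleGraph (Fin n)} {U U' : Finset (Fin n)}
    (h : CopyOff H U G) (hU : U ⊆ U') (hG : G ≤ G') : CopyOff H U' G' := by
  obtain ⟨φ, h1, h2⟩ := h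
  exact ⟨φ, h1, fun x y hxy hx hy =>
    hG (h2 x y hxy (fun h => hx (hU h)) (fun h => hy (hU h)))⟩

lemma CopyOff.containsCopy {H G : SimpleGraph (Fin n)} (h : CopyOff H ∅ G) :
    ContainsCopy G H := by
  obtain ⟨φ, h1, h2⟩ := h
  exact ⟨φ, h1, fun x y hxy => h2 x y hxy (by simp) (by simp)⟩

/-- The edges needed to exchange the positions of `u` and `w` in the embedding `φ`. -/
noncomputable def swapEdges (H : SimpleGraph (Fin n)) (φ : Fin n → Fin n) (u w : Fin n) :
    Finset (Sym2 (Fin n)) :=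
  (nbrs H u).image (fun x => s(φ w, φ x)) ∪ (nbrs H w).image (fun y => s(φ u, φ y))

lemma card_swapEdges_le {H : SimpleGraph (Fin n)} {D : ℕ} (hD : ∀ v, #(nbrs H v) ≤ D)
    (φ : Fin n → Fin n) (u w : Fin n) : #(swapEdges H φ u w) ≤ 2 * D := by
  refine (card_union_le _ _).trans ?_
  have h1 := (card_image_le (s := nbrs H u) (f := fun x => s(φ w, φ x))).trans (hD u)
  have h2 := (card_image_le (s := nbrs H w) (f := fun y => s(φ u, φ y))).trans (hD w)
  omega

/-- A system of candidates for the members of `I`: vertices far away from `I` and from each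
other. -/
structure IsCandidates (H : SimpleGraph (Fin n)) (I : Finset (Fin n)) (r : ℕ)
    (w : Fin n → ℕ → Fin n) : Prop where
  not_mem : ∀ u ∈ I, ∀ i < r, w u i ∉ I
  not_adj : ∀ u ∈ I, ∀ i < r, ∀ v ∈ I, ¬ H.Adj v (w u i)
  ne : ∀ u ∈ I, ∀ i < r, ∀ v ∈ I, ∀ j < r, (u, i) ≠ (v, j) → w u i ≠ w v j
  not_adj' : ∀ u ∈ I, ∀ i < r, ∀ v ∈ I, ∀ j < r, (u, i) ≠ (v, j) → ¬ H.Adj (w u i) (w v j)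
  no_common : ∀ u ∈ I, ∀ i < r, ∀ v ∈ I, ∀ j < r, (u, i) ≠ (v, j) →
    ∀ y, H.Adj (w u i) y → ¬ H.Adj (w v j) y

lemma IsCandidates.not_isDiag {H : SimpleGraph (Fin n)} {I : Finset (Fin n)} {r : ℕ}
    {w : Fin n → ℕ → Fin n} (hw : IsCandidates H I r w) {φ : Fin n → Fin n}
    (hφ : Function.Injective φ) {u : Fin n} (hu : u ∈ I) {i : ℕ} (hi : i < r) :
    ∀ e ∈ swapEdges H φ u (w u i), ¬ e.IsDiag := by
  intro e he
  simp only [swapEdges, mem_union, mem_image, mem_nbrs] at he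
  rcases he with ⟨x, hx, rfl⟩ | ⟨y, hy, rfl⟩
  · rw [Sym2.mk_isDiag_iff]
    intro h
    exact hw.not_adj u hu i hi u hu (hφ h ▸ hx)
  · rw [Sym2.mk_isDiag_iff]
    intro h
    exact hw.not_adj u hu i hi u hu ((hφ h).symm ▸ hy.symm)

lemma IsCandidates.disjoint {H : SimpleGraph (Fin n)} {I : Finset (Fin n)} {r : ℕ}
    {w : Fin n → ℕ → Fin n} (hw : IsCandidates H I r w) {φ : Fin n → Fin n}
    (hφ : Function.Injective φ) {u : Fin n} (hu : u ∈ I) {i : ℕ} (hi : i < r)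
    {v : Fin n} (hv : v ∈ I) {j : ℕ} (hj : j < r) (hne : (u, i) ≠ (v, j)) :
    Disjoint (swapEdges H φ u (w u i)) (swapEdges H φ v (w v j)) := by
  rw [Finset.disjoint_left]
  intro e he he'
  simp only [swapEdges, mem_union, mem_image, mem_nbrs] at he he'
  rcases he with ⟨x, hx, rfl⟩ | ⟨x, hx, rfl⟩ <;> rcases he' with ⟨y, hy, h⟩ | ⟨y, hy, h⟩ <;>
    rw [Sym2.eq_iff] at h <;> rcases h with ⟨ha, hb⟩ | ⟨ha, hb⟩ <;>
    replace ha := hφ ha <;> replace hb := hφ hb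
  · exact hw.ne u hu i hi v hv j hj hne ha.symm
  · exact hw.not_adj v hv j hj u hu (ha ▸ hx)
  · exact hw.not_mem u hu i hi (ha ▸ hv)
  · exact hw.not_adj' u hu i hi v hv j hj hne (hb ▸ hy.symm)
  · exact hw.not_mem v hv j hj (ha ▸ hu)
  · exact hw.not_adj' u hu i hi v hv j hj hne (ha ▸ hx)
  · exact hw.no_common u hu i hi v hv j hj hne x hx (hb ▸ hy)
  · exact hw.not_adj u hu i hi v hv (ha ▸ hx.symm)

end Covers

section Swap

open Finset
open scoped Classical

variable {n : ℕ}

lemma CopyOff.swap {H G G' : SimpleGraph (Fin n)} {I U Z : Finset (Fin n)} {r : ℕ}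
    {w : Fin n → ℕ → Fin n} (hw : IsCandidates H I r w) {φ : Fin n → Fin n}
    (hφ : Function.Injective φ)
    (hcopy : ∀ x y, H.Adj x y → x ∉ U → y ∉ U → G.Adj (φ x) (φ y)) (hG : G ≤ G')
    (hI : ∀ u ∈ I, ∀ v ∈ I, ¬ H.Adj u v)
    (hs : ∀ u ∈ I \ Z, ∃ i < r, ∀ e ∈ swapEdges H φ u (w u i), e ∈ G'.edgeSet) :
    CopyOff H ((U \ I) ∪ Z) G' := by
  choose! i hi he using hs
  set A := I \ Z with hA
  set c : Fin n → Fin n := fun u => w u (i u) with hc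
  have hAI : ∀ u ∈ A, u ∈ I := fun u hu => (Finset.mem_sdiff.1 hu).1
  have hcI : ∀ u ∈ A, c u ∉ I := fun u hu => hw.not_mem u (hAI u hu) _ (hi u hu)
  have hpair : ∀ u v, u ≠ v → ((u, i u) : Fin n × ℕ) ≠ (v, i v) := fun u v h h' =>
    h (Prod.ext_iff.1 h').1
  have hcinj : ∀ u ∈ A, ∀ v ∈ A, c u = c v → u = v := fun u hu v hv h => by
    by_contra huv
    exact hw.ne u (hAI u hu) _ (hi u hu) v (hAI v hv) _ (hi v hv) (hpair u v huv) h
  set π : Fin n → Fin n := fun x =>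
    if x ∈ A then c x else if h : ∃ u ∈ A, c u = x then h.choose else x with hπ
  have hπA : ∀ x ∈ A, π x = c x := fun x hx => by simp [hπ, hx]
  have hπc : ∀ u ∈ A, π (c u) = u := by
    intro u hu
    have h1 : c u ∉ A := fun h => hcI u hu (hAI _ h)
    have h2 : ∃ v ∈ A, c v = c u := ⟨u, hu, rfl⟩
    have : π (c u) = h2.choose := by simp only [hπ, h1, if_false, dif_pos h2]
    rw [this]
    exact hcinj _ h2.choose_spec.1 _ hu h2.choose_spec.2
  have hπo : ∀ x, x ∉ A → (∀ u ∈ A, c u ≠ x) → π x = x := by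
    intro x hx h
    have h2 : ¬ ∃ v ∈ A, c v = x := by push Not; exact h
    simp only [hπ, hx, if_false, dif_neg h2]
  have hππ : Function.Involutive π := by
    intro x
    by_cases hx : x ∈ A
    · rw [hπA x hx, hπc x hx]
    · by_cases h : ∃ u ∈ A, c u = x
      · obtain ⟨u, hu, rfl⟩ := h
        rw [hπc u hu, hπA u hu]
      · push Not at h
        rw [hπo x hx h, hπo x hx h]
  have hout : ∀ x, x ∉ (U \ I) ∪ Z → x ∉ A → x ∉ U := by
    intro x hx hxA hxU
    simp only [mem_union, Finset.mem_sdiff, not_or, hA] at hx hxA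
    tauto
  have key1 : ∀ x y, H.Adj x y → x ∈ A → G'.Adj (φ (π x)) (φ (π y)) := by
    intro x y hxy hx
    have hy : y ∉ A := fun hy => hI x (hAI x hx) y (hAI y hy) hxy
    have hy' : ∀ v ∈ A, c v ≠ y := fun v hv h =>
      hw.not_adj v (hAI v hv) _ (hi v hv) x (hAI x hx) (by
        have h : w v (i v) = y := h
        rw [h]; exact hxy)
    rw [hπA x hx, hπo y hy hy']
    refine (SimpleGraph.mem_edgeSet _).1 (he x hx _ ?_)
    exact mem_union_left _ (mem_image.2 ⟨y, mem_nbrs.2 hxy, rfl⟩)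
  have key2 : ∀ u y, u ∈ A → H.Adj (c u) y → y ∉ A → G'.Adj (φ (π (c u))) (φ (π y)) := by
    intro u y hu hxy hy
    have hy' : ∀ v ∈ A, c v ≠ y := by
      rintro v hv rfl
      by_cases huv : u = v
      · subst huv
        exact hxy.ne rfl
      · exact hw.not_adj' u (hAI u hu) _ (hi u hu) v (hAI v hv) _ (hi v hv) (hpair u v huv) hxy
    rw [hπc u hu, hπo y hy hy']
    refine (SimpleGraph.mem_edgeSet _).1 (he u hu _ ?_)
    exact mem_union_right _ (mem_image.2 ⟨y, mem_nbrs.2 hxy, rfl⟩)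
  refine ⟨φ ∘ π, hφ.comp hππ.injective, fun x y hxy hx hy => ?_⟩
  by_cases hxA : x ∈ A
  · exact key1 x y hxy hxA
  by_cases hyA : y ∈ A
  · exact (key1 y x hxy.symm hyA).symm
  by_cases hxc : ∃ u ∈ A, c u = x
  · obtain ⟨u, hu, rfl⟩ := hxc
    exact key2 u y hu hxy hyA
  by_cases hyc : ∃ u ∈ A, c u = y
  · obtain ⟨u, hu, rfl⟩ := hyc
    exact (key2 u x hu hxy.symm hxA).symm
  push Not at hxc hyc
  simp only [Function.comp]
  rw [hπo x hxA hxc, hπo y hyA hyc]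
  exact hG (hcopy x y hxy (hout x hx hxA) (hout y hy hyA))

lemma exists_isCandidates {H : SimpleGraph (Fin n)} {D : ℕ} (hD : ∀ v, #(nbrs H v) ≤ D)
    (I : Finset (Fin n)) (r : ℕ)
    (hn : #I * (D + 1) + (D + 1) ^ 2 * (#I * r) ≤ n) :
    ∃ w, IsCandidates H I r w := by
  set A : Finset (Fin n) := univ \ (I ∪ I.biUnion (nbrs H)) with hA
  have hAcard : (D + 1) ^ 2 * (#I * r) ≤ #A := by
    have h1 : #(I ∪ I.biUnion (nbrs H)) ≤ #I * (D + 1) := by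
      refine (card_union_le _ _).trans ?_
      have := card_biUnion_le_card_mul I (nbrs H) D fun v _ => hD v
      rw [mul_add, mul_one]; omega
    have h2 : #A = n - #(I ∪ I.biUnion (nbrs H)) := by
      rw [hA, ← compl_eq_univ_sdiff, card_compl, Fintype.card_fin]
    omega
  set R : Fin n → Fin n → Prop := fun x y => H.Adj x y ∨ ∃ z, H.Adj x z ∧ H.Adj y z with hR
  obtain ⟨J, hJA, hJ, hJR⟩ := exists_independent R
    (fun a b h => h.imp (fun h => h.symm) fun ⟨z, h1, h2⟩ => ⟨z, h2, h1⟩) ((D + 1) ^ 2) A (by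
      intro u _
      refine ⟨nbrs H u ∪ (nbrs H u).biUnion (nbrs H), ?_, fun v _ _ hv => ?_⟩
      swap
      · obtain h | ⟨z, h1, h2⟩ := hv
        · exact mem_union_left _ (mem_nbrs.2 h)
        · exact mem_union_right _ (mem_biUnion.2 ⟨z, mem_nbrs.2 h1, mem_nbrs.2 h2.symm⟩)
      have h1 := card_union_le (nbrs H u) ((nbrs H u).biUnion (nbrs H))
      have h2 := (card_biUnion_le_card_mul (nbrs H u) (nbrs H) D fun v _ => hD v).trans
        (Nat.mul_le_mul_right D (hD u))
      have h3 := hD u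
      nlinarith)
  have hJcard : #(I ×ˢ range r) ≤ #J := by
    rw [card_product, card_range]
    exact Nat.le_of_mul_le_mul_left (hAcard.trans hJ) (by positivity)
  obtain ⟨g, hgJ, hginj⟩ : ∃ g : Fin n × ℕ → Fin n,
      (∀ p ∈ I ×ˢ range r, g p ∈ J) ∧ Set.InjOn g (I ×ˢ range r : Finset (Fin n × ℕ)) := by
    rcases (I ×ˢ range r).eq_empty_or_nonempty with h0 | ⟨p, hp⟩
    · rcases Nat.eq_zero_or_pos n with hn0 | hn0
      · subst hn0
        exact ⟨fun p => p.1, by simp [h0], by simp [h0]⟩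
      · exact ⟨fun _ => ⟨0, hn0⟩, by simp [h0], by simp [h0]⟩
    · have hJ0 : J.Nonempty := card_pos.1 (lt_of_lt_of_le (card_pos.2 ⟨p, hp⟩) hJcard)
      have : Nonempty (Fin n) := ⟨p.1⟩
      obtain ⟨g, hg1, hg2⟩ := (I ×ˢ range r).finite_toSet.exists_injOn_of_encard_le
        (t := (J : Set (Fin n)))
        (by simpa only [Set.encard_coe_eq_coe_finsetCard, Nat.cast_le] using hJcard)
      exact ⟨g, fun p hp => hg1 hp, hg2⟩
  have hmem : ∀ u ∈ I, ∀ i < r, (u, i) ∈ I ×ˢ range r := fun u hu i hi =>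
    mem_product.2 ⟨hu, mem_range.2 hi⟩
  have hJ' : ∀ u ∈ I, ∀ i < r, g (u, i) ∈ A := fun u hu i hi => hJA (hgJ _ (hmem u hu i hi))
  have hAn : ∀ x ∈ A, x ∉ I ∧ ∀ v ∈ I, ¬ H.Adj v x := by
    intro x hx
    rw [hA, Finset.mem_sdiff, mem_union, mem_biUnion] at hx
    refine ⟨fun h => hx.2 (Or.inl h), fun v hv h => hx.2 (Or.inr ⟨v, hv, mem_nbrs.2 h⟩)⟩
  have hne : ∀ u ∈ I, ∀ i < r, ∀ v ∈ I, ∀ j < r, (u, i) ≠ (v, j) → g (u, i) ≠ g (v, j) :=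
    fun u hu i hi v hv j hj h h' => h (hginj (hmem u hu i hi) (hmem v hv j hj) h')
  have hRg : ∀ u ∈ I, ∀ i < r, ∀ v ∈ I, ∀ j < r, (u, i) ≠ (v, j) → ¬ R (g (u, i)) (g (v, j)) :=
    fun u hu i hi v hv j hj h => hJR _ (hgJ _ (hmem u hu i hi)) _ (hgJ _ (hmem v hv j hj))
      (hne u hu i hi v hv j hj h)
  exact ⟨fun u i => g (u, i), {
    not_mem := fun u hu i hi => (hAn _ (hJ' u hu i hi)).1
    not_adj := fun u hu i hi => (hAn _ (hJ' u hu i hi)).2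
    ne := hne
    not_adj' := fun u hu i hi v hv j hj h h' => hRg u hu i hi v hv j hj h (Or.inl h')
    no_common := fun u hu i hi v hv j hj h y h1 h2 =>
      hRg u hu i hi v hv j hj h (Or.inr ⟨y, h1, h2⟩) }⟩

end Swap

section Phases

open Finset
open scoped Classical

variable {n : ℕ}

lemma reach_crowd {ι : Type*} (I : Finset ι) (E : ι → Finset (Sym2 (Fin n)))
    (M : Finset (Sym2 (Fin n))) (hM : ∀ e ∈ M, ¬ e.IsDiag) (c : ℕ) (hc : #M ≤ c * (n / 4))
    (hE : ∀ u ∈ I, E u ⊆ M) (m : ℕ) (hm : ∀ u ∈ I, #(E u) ≤ m) (h x t d k : ℕ)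
    (hd : ∀ u ∈ I, ∃ N : Finset ι, #N < d ∧ ∀ v ∈ I, v ≠ u → ¬ Disjoint (E u) (E v) → v ∈ N)
    (hk : #I ≤ k) (G : SimpleGraph (Fin n)) :
    Reach (c * t) (k.choose (x + 1) * ((x + 1) * m).choose ((x + 1) * h) *
      Real.exp (-(t : ℝ) / (2 * n)) ^ ((x + 1) * h)) G
      fun G' => #{u ∈ I | h ≤ #(missing (E u) G')} ≤ d * x := by
  refine (reach_group I E M hM c hc hE m hm h x t G).mono le_rfl ?_ fun G' _ hG' => ?_
  · gcongr
  · by_contra! hcon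
    set V : Finset ι := {u ∈ I | h ≤ #(missing (E u) G')} with hV
    obtain ⟨J, hJV, hJ, hJd⟩ := exists_independent (fun u v => ¬ Disjoint (E u) (E v))
      (fun a b h h' => h h'.symm) d V fun u hu => by
        obtain ⟨N, hN, hN'⟩ := hd u (mem_filter.1 hu).1
        exact ⟨N, hN, fun v hv => hN' v (mem_filter.1 hv).1⟩
    have hlt : x < #J := Nat.lt_of_mul_lt_mul_left (hcon.trans_le hJ)
    obtain ⟨S, hSJ, hS⟩ := exists_subset_card_eq (show x + 1 ≤ #J from hlt)
    obtain ⟨u, hu, hlt⟩ := hG' S (fun u hu => (mem_filter.1 (hJV (hSJ hu))).1) hS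
      fun u hu v hv huv => not_not.1 (hJd u (hSJ hu) v (hSJ hv) huv)
    exact absurd (mem_filter.1 (hJV (hSJ hu))).2 (not_le.2 hlt)

lemma card_unfinished_le (J : Finset ℕ) (F : ℕ → Finset (Sym2 (Fin n)))
    (hF : ∀ i ∈ J, ∀ j ∈ J, i ≠ j → Disjoint (F i) (F j)) (G : SimpleGraph (Fin n)) :
    #{i ∈ J | ¬ ∀ e ∈ F i, e ∈ G.edgeSet} ≤ #(missing (J.biUnion F) G) := by
  have hex : ∀ i : ℕ, i ∈ ({i ∈ J | ¬ ∀ e ∈ F i, e ∈ G.edgeSet} : Finset ℕ) →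
      ∃ e ∈ F i, e ∉ G.edgeSet := by
    intro i hi
    have := (mem_filter.1 hi).2
    push Not at this
    exact this
  have hne : ∀ i : ℕ, i ∈ ({i ∈ J | ¬ ∀ e ∈ F i, e ∈ G.edgeSet} : Finset ℕ) → i ∈ J :=
    fun i hi => (mem_filter.1 hi).1
  rcases Finset.eq_empty_or_nonempty
    ({i ∈ J | ¬ ∀ e ∈ F i, e ∈ G.edgeSet} : Finset ℕ) with h0 | ⟨i₀, hi₀⟩
  · rw [h0, card_empty]
    exact Nat.zero_le _
  have : Nonempty (Sym2 (Fin n)) := ⟨(hex i₀ hi₀).choose⟩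
  choose! e he heG using hex
  refine card_le_card_of_injOn e (fun i hi => ?_) fun i hi j hj hij => ?_
  · exact mem_missing.2 ⟨mem_biUnion.2 ⟨i, hne i hi, he i hi⟩, heG i hi⟩
  · by_contra hne'
    exact Finset.disjoint_left.1 (hF i (hne i hi) j (hne j hj) hne') (he i hi) (hij ▸ he j hj)

/-- From any graph containing a copy of `H` off a set `U`, one can, in time `t` and up to failure
probability `ε`, repair all but `x` vertices of any independent set of at most `k` vertices
of `U`. -/
def Phase (H : SimpleGraph (Fin n)) (k t : ℕ) (ε : ℝ) (x : ℕ) : Prop :=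
  ∀ (I U : Finset (Fin n)) (G : SimpleGraph (Fin n)), I ⊆ U → #I ≤ k →
    (∀ u ∈ I, ∀ v ∈ I, ¬ H.Adj u v) → CopyOff H U G →
    Reach t ε G fun G' => ∃ Z : Finset (Fin n), #Z ≤ x ∧ CopyOff H ((U \ I) ∪ Z) G'

lemma Phase.sweep {H : SimpleGraph (Fin n)} {k t x : ℕ} {ε : ℝ} (hP : Phase H k t ε x)
    (hε : 0 ≤ ε) (c : ℕ) (W V : Finset (Fin n))
    (hV : ∀ u ∈ V, ∃ N : Finset (Fin n), #N < c ∧ ∀ v ∈ V, v ≠ u → H.Adj u v → v ∈ N)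
    (hk : #V ≤ k) (G : SimpleGraph (Fin n)) (hG : CopyOff H (W ∪ V) G) :
    Reach (c * t) (c * ε) G
      fun G' => ∃ Z : Finset (Fin n), #Z ≤ c * x ∧ CopyOff H (W ∪ Z) G' := by
  obtain ⟨f, hf, hf'⟩ := exists_colouring (fun u v => H.Adj u v) (fun _ _ h => h.symm) c V hV
  have key : ∀ j : ℕ, Reach (j * t) (j * ε) G fun G' => ∃ Z : Finset (Fin n), #Z ≤ j * x ∧
      CopyOff H (W ∪ Z ∪ {u ∈ V | j ≤ f u}) G' := by
    intro j
    induction j with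
    | zero =>
      refine (Reach.of_mem (𝒢 := fun G' => CopyOff H (W ∪ V) G') hG).mono (by simp) (by simp)
        fun G' _ h => ⟨∅, by simp, h.mono ?_ le_rfl⟩
      intro u hu
      simp only [mem_union, mem_filter] at hu ⊢
      rcases hu with h | h
      · exact Or.inl (Or.inl h)
      · exact Or.inr ⟨h, Nat.zero_le _⟩
    | succ j ih =>
      have h1 := ih.trans (t := t) (δ := ε) (ℋ := fun G' => ∃ Z : Finset (Fin n),
        #Z ≤ (j + 1) * x ∧ CopyOff H (W ∪ Z ∪ {u ∈ V | j + 1 ≤ f u}) G') hε ?_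
      · exact h1.mono (by rw [add_mul, one_mul]) (by push_cast; linarith) fun _ _ h => h
      · rintro G' - ⟨Z, hZ, hcopy⟩
        refine (hP {u ∈ V | f u = j} _ G' ?_ ?_ ?_ hcopy).mono le_rfl le_rfl ?_
        · intro u hu
          rw [mem_filter] at hu
          exact mem_union_right _ (mem_filter.2 ⟨hu.1, hu.2.ge⟩)
        · exact (card_le_card (filter_subset _ _)).trans hk
        · intro u hu v hv huv
          rw [mem_filter] at hu hv
          exact hf' u hu.1 v hv.1 huv.ne huv (hu.2.trans hv.2.symm)
        · rintro G'' - ⟨Z', hZ', hcopy'⟩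
          refine ⟨Z ∪ Z', (card_union_le _ _).trans (by rw [add_mul]; omega),
            hcopy'.mono ?_ le_rfl⟩
          intro u hu
          simp only [mem_union, Finset.mem_sdiff, mem_filter, not_and] at hu ⊢
          rcases hu with ⟨(h | h) | h, h'⟩ | h
          · exact Or.inl (Or.inl h)
          · exact Or.inl (Or.inr (Or.inl h))
          · have := h' h.1
            exact Or.inr ⟨h.1, by omega⟩
          · exact Or.inl (Or.inr (Or.inr h))
  refine (key c).mono le_rfl le_rfl fun G' _ ⟨Z, hZ, h⟩ => ⟨Z, hZ, h.mono ?_ le_rfl⟩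
  intro u hu
  simp only [mem_union, mem_filter] at hu ⊢
  rcases hu with h | ⟨h, h'⟩
  · exact h
  · have := hf u h
    omega

lemma phase_stars {H : SimpleGraph (Fin n)} {D : ℕ} (hD : ∀ v, #(nbrs H v) ≤ D) (k r x t : ℕ)
    (hcand : k * (D + 1) + (D + 1) ^ 2 * (k * r) ≤ n) (hM : k * (r * (2 * D)) ≤ n / 4) :
    Phase H k t (k.choose (x + 1) * ((x + 1) * (r * (2 * D))).choose ((x + 1) * r) *
      Real.exp (-(t : ℝ) / (2 * n)) ^ ((x + 1) * r)) x := by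
  rintro I U G hIU hI hind ⟨φ, hφ, hcopy⟩
  obtain ⟨w, hw⟩ := exists_isCandidates hD I r (by
    refine le_trans ?_ hcand
    gcongr)
  set E : Fin n → Finset (Sym2 (Fin n)) := fun u =>
    (range r).biUnion fun i => swapEdges H φ u (w u i) with hE
  have hEcard : ∀ u ∈ I, #(E u) ≤ r * (2 * D) := fun u _ => by
    have := card_biUnion_le_card_mul (range r) (fun i => swapEdges H φ u (w u i)) (2 * D)
      fun i _ => card_swapEdges_le hD φ u (w u i)
    rwa [card_range] at this
  have h1 := reach_crowd I E (I.biUnion E) (by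
      intro e he
      obtain ⟨u, hu, he⟩ := mem_biUnion.1 he
      obtain ⟨i, hi, he⟩ := mem_biUnion.1 he
      exact hw.not_isDiag hφ hu (mem_range.1 hi) e he) 1 (by
      rw [one_mul]
      refine (card_biUnion_le_card_mul I E _ hEcard).trans (le_trans ?_ hM)
      gcongr) (fun u hu => subset_biUnion_of_mem E hu) (r * (2 * D)) hEcard r x t 1 k
      (fun u hu => ⟨∅, by simp, fun v hv hvu hdisj => absurd ?_ hdisj⟩) hI G
  · refine h1.mono (by simp) le_rfl fun G' hGG' hcard => ⟨_, by simpa using hcard, ?_⟩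
    refine CopyOff.swap hw hφ hcopy hGG' hind fun u hu => ?_
    rw [Finset.mem_sdiff, mem_filter] at hu
    have hlt : #(missing (E u) G') < r := not_le.1 fun h => hu.2 ⟨hu.1, h⟩
    by_contra! hcon
    have h2 := card_unfinished_le (range r) (fun i => swapEdges H φ u (w u i))
      (fun i hi j hj hij => hw.disjoint hφ hu.1 (mem_range.1 hi) hu.1 (mem_range.1 hj)
        (by simpa using hij)) G'
    rw [filter_true_of_mem, card_range] at h2
    · exact absurd (h2.trans_lt hlt) (lt_irrefl _)
    · intro i hi h
      obtain ⟨e, he, he'⟩ := hcon i (mem_range.1 hi)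
      exact he' (h e he)
  · rw [hE, disjoint_biUnion_left]
    intro i hi
    rw [disjoint_biUnion_right]
    intro j hj
    exact hw.disjoint hφ hu (mem_range.1 hi) hv (mem_range.1 hj)
      (fun h => hvu (Prod.ext_iff.1 h).1.symm)

end Phases

section Halving

open Finset
open scoped Classical

variable {n : ℕ}

/-- The `j`-th element of a finset in an arbitrary enumeration, as a finset with at most one
element. -/
noncomputable def slot {α : Type*} (S : Finset α) (j : ℕ) : Finset α :=
  (S.toList[j]?).toFinset

lemma card_slot_le {α : Type*} (S : Finset α) (j : ℕ) : #(slot S j) ≤ 1 := by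
  unfold slot
  cases S.toList[j]? <;> simp

lemma slot_subset {α : Type*} (S : Finset α) (j : ℕ) : slot S j ⊆ S := by
  intro e he
  rw [slot, Option.mem_toFinset, Option.mem_def] at he
  exact mem_toList.1 (List.mem_of_getElem? he)

lemma exists_mem_slot {α : Type*} {S : Finset α} {e : α} (he : e ∈ S) :
    ∃ j < #S, e ∈ slot S j := by
  obtain ⟨j, hj, h⟩ := List.mem_iff_getElem.1 (mem_toList.2 he)
  rw [length_toList] at hj
  exact ⟨j, hj, by rw [slot, Option.mem_toFinset, Option.mem_def, List.getElem?_eq_some_iff]; exact ⟨_, h⟩⟩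

lemma phase_halving {H : SimpleGraph (Fin n)} {D : ℕ} (hD : ∀ v, #(nbrs H v) ≤ D)
    (k q s x t : ℕ) (hs : 2 * D ≤ s) (hq : 0 < q) {ε : ℝ} (hε : 0 ≤ ε)
    (hcand : k * (D + 1) + (D + 1) ^ 2 * (k * q ^ s) ≤ n) (hM : k * q ^ s ≤ n / 4)
    (hprob : ∀ j < s, (k.choose (x + 1) : ℝ) *
      ((x + 1) * q ^ (j + 1)).choose ((x + 1) * (q ^ (j + 1) - q ^ j + 1)) *
      Real.exp (-(t : ℝ) / (2 * n)) ^ ((x + 1) * (q ^ (j + 1) - q ^ j + 1)) ≤ ε) :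
    Phase H k (s * t) (s * ε) (s * x) := by
  rintro I U G hIU hI hind ⟨φ, hφ, hcopy⟩
  obtain ⟨w, hw⟩ := exists_isCandidates hD I (q ^ s) (by
    refine le_trans ?_ hcand
    gcongr)
  set F : Fin n → ℕ → ℕ → Finset (Sym2 (Fin n)) := fun u j i =>
    slot (swapEdges H φ u (w u i)) j with hF
  have hFdisj : ∀ u ∈ I, ∀ i < q ^ s, ∀ v ∈ I, ∀ i' < q ^ s, (u, i) ≠ (v, i') → ∀ j,
      Disjoint (F u j i) (F v j i') := fun u hu i hi v hv i' hi' hne j =>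
    (hw.disjoint hφ hu hi hv hi' hne).mono (slot_subset _ _) (slot_subset _ _)
  have key : ∀ j ≤ s, Reach (j * t) (j * ε) G fun G' => ∃ Z : Finset (Fin n), #Z ≤ j * x ∧
      ∀ u ∈ I \ Z, ∃ A ⊆ range (q ^ s), #A = q ^ (s - j) ∧
        ∀ i ∈ A, ∀ j' < j, ∀ e ∈ F u j' i, e ∈ G'.edgeSet := by
    intro j
    induction j with
    | zero =>
      intro _
      refine (Reach.of_mem (𝒢 := fun _ => True) trivial).mono (by simp) (by simp)
        fun G' _ _ => ⟨∅, by simp, fun u _ => ⟨range (q ^ s), subset_rfl, by simp, by simp⟩⟩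
    | succ j ih =>
      intro hj
      have h1 := (ih (by omega)).trans (t := t) (δ := ε) (ℋ := fun G' => ∃ Z : Finset (Fin n),
        #Z ≤ (j + 1) * x ∧ ∀ u ∈ I \ Z, ∃ A ⊆ range (q ^ s), #A = q ^ (s - (j + 1)) ∧
          ∀ i ∈ A, ∀ j' < j + 1, ∀ e ∈ F u j' i, e ∈ G'.edgeSet) hε ?_
      · exact h1.mono (by rw [add_mul, one_mul]) (by push_cast; linarith) fun _ _ h => h
      rintro G' - ⟨Z, hZ, hA⟩
      choose! A hA hAcard hAG using hA
      obtain ⟨l, rfl⟩ : ∃ l, s = j + 1 + l := ⟨s - (j + 1), by omega⟩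
      rw [show j + 1 + l - j = l + 1 by omega] at hAcard
      rw [show j + 1 + l - (j + 1) = l by omega]
      have hpow : q ^ l ≤ q ^ (l + 1) := Nat.pow_le_pow_right hq (Nat.le_succ l)
      have hAlt : ∀ u ∈ I \ Z, ∀ i ∈ A u, i < q ^ (j + 1 + l) :=
        fun u hu i hi => mem_range.1 (hA u hu hi)
      have hI' : ∀ u ∈ I \ Z, u ∈ I := fun u hu => (Finset.mem_sdiff.1 hu).1
      set E : Fin n → Finset (Sym2 (Fin n)) := fun u => (A u).biUnion (F u j) with hE
      have hEcard : ∀ u ∈ I \ Z, #(E u) ≤ q ^ (l + 1) := fun u hu => by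
        have := card_biUnion_le_card_mul (A u) (F u j) 1 fun i _ => card_slot_le _ _
        rwa [hAcard u hu, mul_one] at this
      have hIZ : #(I \ Z) ≤ k := (card_le_card sdiff_subset).trans hI
      have h2 := reach_crowd (I \ Z) E ((I \ Z).biUnion E) (by
          intro e he
          obtain ⟨u, hu, he⟩ := mem_biUnion.1 he
          obtain ⟨i, hi, he⟩ := mem_biUnion.1 he
          exact hw.not_isDiag hφ (hI' u hu) (hAlt u hu i hi) e (slot_subset _ _ he)) 1 (by
          rw [one_mul]
          refine (card_biUnion_le_card_mul _ E _ hEcard).trans (le_trans ?_ hM)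
          exact Nat.mul_le_mul hIZ (Nat.pow_le_pow_right hq (by omega)))
          (fun u hu => subset_biUnion_of_mem E hu) (q ^ (l + 1)) hEcard
          (q ^ (l + 1) - q ^ l + 1) x t 1 k
          (fun u hu => ⟨∅, by simp, fun v hv hvu hdisj => absurd ?_ hdisj⟩) hIZ G'
      · refine h2.mono (by simp) (hprob l (by omega)) fun G'' hGG' hcard => ?_
        refine ⟨Z ∪ {u ∈ I \ Z | q ^ (l + 1) - q ^ l + 1 ≤ #(missing (E u) G'')}, ?_, ?_⟩
        · refine (card_union_le _ _).trans ?_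
          rw [add_mul]
          exact Nat.add_le_add hZ hcard
        intro u hu
        rw [Finset.mem_sdiff, mem_union, not_or, mem_filter] at hu
        have hu' : u ∈ I \ Z := Finset.mem_sdiff.2 ⟨hu.1, hu.2.1⟩
        have hlt : #(missing (E u) G'') ≤ q ^ (l + 1) - q ^ l :=
          Nat.le_of_lt_succ (not_le.1 fun h => hu.2.2 ⟨hu', h⟩)
        have h3 := card_unfinished_le (A u) (F u j) (fun i hi i' hi' hne =>
          hFdisj u hu.1 i (hAlt u hu' i hi) u hu.1 i' (hAlt u hu' i' hi') (by simpa using hne) j) G''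
        have h4 := card_filter_add_card_filter_not (s := A u)
          (fun i => ∀ e ∈ F u j i, e ∈ G''.edgeSet)
        have h5 : q ^ l ≤ #{i ∈ A u | ∀ e ∈ F u j i, e ∈ G''.edgeSet} := by
          have h6 := h3.trans hlt
          rw [hAcard u hu'] at h4
          omega
        obtain ⟨B, hB, hBcard⟩ := exists_subset_card_eq h5
        refine ⟨B, (hB.trans (filter_subset _ _)).trans (hA u hu'), hBcard, fun i hi j' hj' e he => ?_⟩
        have hi' := mem_filter.1 (hB hi)
        rcases Nat.lt_succ_iff_lt_or_eq.1 hj' with h | rfl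
        · exact SimpleGraph.edgeSet_mono hGG' (hAG u hu' i hi'.1 j' h e he)
        · exact hi'.2 e he
      · rw [hE, disjoint_biUnion_left]
        intro i hi
        rw [disjoint_biUnion_right]
        intro i' hi'
        exact hFdisj u (hI' u hu) i (hAlt u hu i hi) v (hI' v hv) i' (hAlt v hv i' hi')
          (fun h => hvu (Prod.ext_iff.1 h).1.symm) j
  refine (key s le_rfl).mono le_rfl le_rfl fun G' hGG' ⟨Z, hZ, hA⟩ => ⟨Z, hZ, ?_⟩
  refine CopyOff.swap hw hφ hcopy hGG' hind fun u hu => ?_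
  obtain ⟨A, hAs, hAcard, hAG⟩ := hA u hu
  rw [Nat.sub_self, pow_zero] at hAcard
  obtain ⟨i, hi⟩ := card_pos.1 (show 0 < #A by omega)
  refine ⟨i, mem_range.1 (hAs hi), fun e he => ?_⟩
  obtain ⟨j, hj, hej⟩ := exists_mem_slot he
  exact hAG i hi j (hj.trans_le ((card_swapEdges_le hD φ u _).trans hs)) e hej

end Halving

section Estimates

lemma choose_le_exp {N r : ℕ} {R β : ℝ} (hβ : 0 ≤ β) (hN : (N : ℝ) ≤ Real.exp β * R)
    (hr : (r : ℝ) ≤ R) : (N.choose r : ℝ) ≤ Real.exp ((1 + β) * R) := by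
  have h1 : (N.choose r : ℝ) * Real.exp (-β) ^ r ≤ (1 + Real.exp (-β)) ^ N := by
    rcases le_or_gt r N with h | h
    · rw [add_comm, add_pow]
      have := Finset.single_le_sum (f := fun m => Real.exp (-β) ^ m * 1 ^ (N - m) * (N.choose m : ℝ))
        (s := Finset.range (N + 1)) (fun i _ => by positivity) (Finset.mem_range.2 (Nat.lt_succ_of_le h))
      refine le_trans (le_of_eq ?_) this
      simp [mul_comm]
    · rw [Nat.choose_eq_zero_of_lt h]
      simp only [Nat.cast_zero, zero_mul]
      positivity
  have h2 : (1 + Real.exp (-β)) ^ N ≤ Real.exp R := by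
    calc (1 + Real.exp (-β)) ^ N ≤ Real.exp (Real.exp (-β)) ^ N := by
          gcongr
          linarith [Real.add_one_le_exp (Real.exp (-β))]
      _ = Real.exp (N * Real.exp (-β)) := (Real.exp_nat_mul _ _).symm
      _ ≤ Real.exp (Real.exp β * R * Real.exp (-β)) := by gcongr
      _ = Real.exp R := by
          rw [mul_right_comm, ← Real.exp_add, add_neg_cancel, Real.exp_zero, one_mul]
  calc (N.choose r : ℝ) = (N.choose r : ℝ) * Real.exp (-β) ^ r * Real.exp (β * r) := by
        rw [← Real.exp_nat_mul, mul_assoc, ← Real.exp_add]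
        simp [mul_comm]
    _ ≤ Real.exp R * Real.exp (β * r) := by
        gcongr
        exact h1.trans h2
    _ = Real.exp (R + β * r) := (Real.exp_add _ _).symm
    _ ≤ Real.exp ((1 + β) * R) := by
        gcongr
        nlinarith

lemma exp_neg_div_le {n t : ℕ} {τ : ℝ} (hn : 0 < n) (ht : 2 * τ * n ≤ t) :
    Real.exp (-(t : ℝ) / (2 * n)) ≤ Real.exp (-τ) := by
  have : (0 : ℝ) < n := by exact_mod_cast hn
  gcongr
  rw [div_le_iff₀ (by positivity)]
  linarith

lemma crowd_prob_le {n k x m h t : ℕ} {α β τ : ℝ} (hn : 0 < n) (hα : 0 ≤ α) (hβ : 0 ≤ β)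
    (hk : (k : ℝ) ≤ Real.exp α * (x + 1)) (hm : (m : ℝ) ≤ Real.exp β * h)
    (ht : 2 * τ * n ≤ t) :
    (k.choose (x + 1) : ℝ) * ((x + 1) * m).choose ((x + 1) * h) *
      Real.exp (-(t : ℝ) / (2 * n)) ^ ((x + 1) * h) ≤
      Real.exp ((x + 1) * (1 + α - h * (τ - 1 - β))) := by
  have h1 : (k.choose (x + 1) : ℝ) ≤ Real.exp ((1 + α) * (x + 1)) :=
    choose_le_exp hα hk (by push_cast; exact le_rfl)
  have h2 : (((x + 1) * m).choose ((x + 1) * h) : ℝ) ≤ Real.exp ((1 + β) * ((x + 1) * h)) := by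
    refine choose_le_exp hβ ?_ (by push_cast; exact le_rfl)
    push_cast
    calc ((x : ℝ) + 1) * m ≤ (x + 1) * (Real.exp β * h) := by gcongr
      _ = _ := by ring
  have h3 : Real.exp (-(t : ℝ) / (2 * n)) ^ ((x + 1) * h) ≤ Real.exp (-τ * ((x + 1) * h)) := by
    calc Real.exp (-(t : ℝ) / (2 * n)) ^ ((x + 1) * h) ≤ Real.exp (-τ) ^ ((x + 1) * h) := by
          exact pow_le_pow_left₀ (Real.exp_pos _).le (exp_neg_div_le hn ht) _
      _ = _ := by
          rw [← Real.exp_nat_mul]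
          push_cast
          ring_nf
  calc _ ≤ Real.exp ((1 + α) * (x + 1)) * Real.exp ((1 + β) * ((x + 1) * h)) *
        Real.exp (-τ * ((x + 1) * h)) := by gcongr
    _ = _ := by
        rw [← Real.exp_add, ← Real.exp_add]
        ring_nf

lemma halving_prob_le {n k x q t : ℕ} {α β τ : ℝ} (hn : 0 < n) (hα : 0 ≤ α) (hβ : 0 ≤ β)
    (hq : 0 < q) (hk : (k : ℝ) ≤ Real.exp α * (x + 1)) (hqβ : (q : ℝ) ≤ Real.exp β)
    (ht : 2 * τ * n ≤ t) (hτ : 0 ≤ τ) (hpos : 0 ≤ τ * (q - 1) - 1 - β) (j : ℕ) :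
    (k.choose (x + 1) : ℝ) * ((x + 1) * q ^ (j + 1)).choose ((x + 1) * (q ^ (j + 1) - q ^ j + 1)) *
      Real.exp (-(t : ℝ) / (2 * n)) ^ ((x + 1) * (q ^ (j + 1) - q ^ j + 1)) ≤
      Real.exp ((x + 1) * (1 + α - (τ * (q - 1) - 1 - β))) := by
  set b : ℝ := (q : ℝ) ^ j with hb
  have hb1 : 1 ≤ b := one_le_pow₀ (by exact_mod_cast hq)
  have hle : q ^ j ≤ q ^ (j + 1) := Nat.pow_le_pow_right hq (Nat.le_succ j)
  have hpos' : 0 < q ^ j := pow_pos hq j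
  have h1 : (k.choose (x + 1) : ℝ) ≤ Real.exp ((1 + α) * (x + 1)) :=
    choose_le_exp hα hk (by push_cast; exact le_rfl)
  have h2 : (((x + 1) * q ^ (j + 1)).choose ((x + 1) * (q ^ (j + 1) - q ^ j + 1)) : ℝ) ≤
      Real.exp ((1 + β) * ((x + 1) * b)) := by
    have hsplit : (x + 1) * q ^ (j + 1) =
        (x + 1) * (q ^ (j + 1) - q ^ j + 1) + (x + 1) * (q ^ j - 1) := by
      rw [← mul_add]
      congr 1
      omega
    rw [Nat.choose_symm_of_eq_add hsplit]
    refine choose_le_exp hβ ?_ ?_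
    · push_cast
      calc ((x : ℝ) + 1) * q ^ (j + 1) = q * ((x + 1) * b) := by rw [hb]; ring
        _ ≤ _ := by gcongr
    · have : ((q ^ j - 1 : ℕ) : ℝ) ≤ b := by
        rw [Nat.cast_sub hpos']
        push_cast
        linarith
      push_cast
      gcongr
  have h3 : Real.exp (-(t : ℝ) / (2 * n)) ^ ((x + 1) * (q ^ (j + 1) - q ^ j + 1)) ≤
      Real.exp (-τ * ((x + 1) * (b * (q - 1)))) := by
    calc Real.exp (-(t : ℝ) / (2 * n)) ^ ((x + 1) * (q ^ (j + 1) - q ^ j + 1))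
        ≤ Real.exp (-τ) ^ ((x + 1) * (q ^ (j + 1) - q ^ j + 1)) := by
          exact pow_le_pow_left₀ (Real.exp_pos _).le (exp_neg_div_le hn ht) _
      _ ≤ Real.exp (-τ) ^ ((x + 1) * (q ^ (j + 1) - q ^ j)) := by
          refine pow_le_pow_of_le_one (Real.exp_pos _).le (Real.exp_le_one_iff.2 (by linarith)) ?_
          gcongr
          omega
      _ = _ := by
          rw [← Real.exp_nat_mul]
          push_cast [Nat.cast_sub hle]
          rw [hb]
          ring_nf
  calc _ ≤ Real.exp ((1 + α) * (x + 1)) * Real.exp ((1 + β) * ((x + 1) * b)) *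
        Real.exp (-τ * ((x + 1) * (b * (q - 1)))) := by gcongr
    _ = Real.exp ((x + 1) * (1 + α - b * (τ * (q - 1) - 1 - β))) := by
        rw [← Real.exp_add, ← Real.exp_add]
        ring_nf
    _ ≤ _ := by
        gcongr
        nlinarith

end Estimates

section Cover

open Finset
open scoped Classical

variable {n : ℕ}

/-- The edges of `H`. -/
noncomputable def edges (H : SimpleGraph (Fin n)) : Finset (Sym2 (Fin n)) :=
  {e | e ∈ H.edgeSet}

lemma mem_edges {H : SimpleGraph (Fin n)} {e : Sym2 (Fin n)} : e ∈ edges H ↔ e ∈ H.edgeSet := by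
  simp [edges]

lemma not_isDiag_of_mem_edges {H : SimpleGraph (Fin n)} :
    ∀ e ∈ edges H, ¬ e.IsDiag := fun _ he => H.not_isDiag_of_mem_edgeSet (mem_edges.1 he)

lemma two_mul_card_edges_le {H : SimpleGraph (Fin n)} {D : ℕ} (hD : ∀ v, #(nbrs H v) ≤ D) :
    2 * #(edges H) ≤ n * D := by
  have h1 : edges H = H.edgeFinset := by
    ext e
    rw [mem_edges, SimpleGraph.mem_edgeFinset]
  have h2 : ∀ v, #(nbrs H v) = H.degree v := by
    intro v
    rw [← SimpleGraph.card_neighborFinset_eq_degree]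
    congr 1
    ext y
    simp
  rw [h1, ← SimpleGraph.sum_degrees_eq_twice_card_edges]
  calc ∑ v, H.degree v ≤ ∑ _v : Fin n, D := sum_le_sum fun v _ => h2 v ▸ hD v
    _ = n * D := by simp

lemma reach_cover {H : SimpleGraph (Fin n)} {D : ℕ} (hD : ∀ v, #(nbrs H v) ≤ D)
    (k h y t : ℕ) (G : SimpleGraph (Fin n)) (hk : #(missing (edges H) G) ≤ k) (hkn : k ≤ n / 4) :
    Reach t (n.choose (y + 1) * ((y + 1) * (D * D)).choose ((y + 1) * h) *
      Real.exp (-(t : ℝ) / (2 * n)) ^ ((y + 1) * h)) G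
      fun G' => ∃ W V : Finset (Fin n), #W ≤ (D * D + 1) * y ∧ #V ≤ k ∧
        (∀ u ∈ V, ∃ N : Finset (Fin n), #N < h ∧ ∀ v ∈ V, v ≠ u → H.Adj u v → v ∈ N) ∧
        CopyOff H (W ∪ V) G' := by
  set M := missing (edges H) G with hM
  set lo : Sym2 (Fin n) → Fin n := fun e => (Quot.out e).1 with hlo
  have hloe : ∀ e, lo e ∈ e := fun e => Sym2.out_fst_mem e
  set E : Fin n → Finset (Sym2 (Fin n)) := fun u => {e ∈ M | H.Adj u (lo e)} with hE
  have hmemE : ∀ u e, e ∈ E u ↔ e ∈ M ∧ H.Adj u (lo e) := fun u e => mem_filter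
  have hEcard : ∀ u ∈ (univ : Finset (Fin n)), #(E u) ≤ D * D := by
    intro u _
    have hsub : E u ⊆ (nbrs H u).biUnion fun y => (nbrs H y).image fun z => s(y, z) := by
      intro e he
      rw [hmemE] at he
      obtain ⟨z, hz⟩ := hloe e
      refine mem_biUnion.2 ⟨lo e, mem_nbrs.2 he.2, mem_image.2 ⟨z, mem_nbrs.2 ?_, hz.symm⟩⟩
      have h1 := mem_edges.1 (missing_subset _ _ he.1)
      rw [hz] at h1
      exact h1
    refine (card_le_card hsub).trans ((card_biUnion_le_card_mul _ _ D fun y _ => ?_).trans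
      (Nat.mul_le_mul_right D (hD u)))
    exact card_image_le.trans (hD y)
  have h1 := reach_crowd univ E M
    (fun e he => not_isDiag_of_mem_edges e (missing_subset _ _ he)) 1 (by omega)
    (fun u _ => filter_subset _ _) (D * D) hEcard h y t (D * D + 1) n (fun u _ => by
      refine ⟨(nbrs H u).biUnion (nbrs H), ?_, fun v _ _ hdisj => ?_⟩
      · exact Nat.lt_succ_of_le ((card_biUnion_le_card_mul _ _ D fun v _ => hD v).trans
          (Nat.mul_le_mul_right D (hD u)))
      · rw [Finset.not_disjoint_iff] at hdisj
        obtain ⟨e, he, he'⟩ := hdisj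
        rw [hmemE] at he he'
        exact mem_biUnion.2 ⟨lo e, mem_nbrs.2 he.2, mem_nbrs.2 he'.2.symm⟩) (by simp) G
  refine h1.mono (by simp) le_rfl fun G' hGG' hcard => ?_
  have hsub : missing (edges H) G' ⊆ M := missing_anti _ hGG'
  set W : Finset (Fin n) := {u ∈ univ | h ≤ #(missing (E u) G')} with hW
  refine ⟨W, (missing (edges H) G').image lo \ W, hcard,
    (card_le_card sdiff_subset).trans (card_image_le.trans ((card_le_card hsub).trans hk)),
    fun u hu => ⟨(missing (E u) G').image lo, ?_, fun v hv _ huv => ?_⟩, id,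
    Function.injective_id, fun x y hxy hx hy => ?_⟩
  · refine card_image_le.trans_lt (not_le.1 fun hle => ?_)
    exact (Finset.mem_sdiff.1 hu).2 (mem_filter.2 ⟨mem_univ _, hle⟩)
  · obtain ⟨e, he, rfl⟩ := mem_image.1 (Finset.mem_sdiff.1 hv).1
    exact mem_image_of_mem _ (mem_missing.2
      ⟨(hmemE u e).2 ⟨hsub he, huv⟩, (mem_missing.1 he).2⟩)
  · by_contra hcon
    have hmiss : s(x, y) ∈ missing (edges H) G' := mem_missing.2 ⟨mem_edges.2 hxy, hcon⟩
    have h2 : lo s(x, y) ∈ W ∪ (missing (edges H) G').image lo \ W := by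
      rw [union_sdiff_self_eq_union]
      exact mem_union_right _ (mem_image_of_mem _ hmiss)
    rcases Sym2.mem_iff.1 (hloe s(x, y)) with h3 | h3 <;> rw [h3] at h2
    · exact hx h2
    · exact hy h2

end Cover

section TailStep

open Finset
open scoped Classical

variable {n : ℕ}

lemma log_le_div_add {x c : ℝ} (hx : 0 < x) (hc : 0 < c) :
    Real.log x ≤ x / c + Real.log c := by
  have h := Real.log_le_sub_one_of_pos (div_pos hx hc)
  rw [Real.log_div hx.ne' hc.ne'] at h
  linarith

lemma log_sixty_four_le : Real.log 64 ≤ 5 := by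
  rw [show (64 : ℝ) = 2 ^ 6 by norm_num, Real.log_pow]
  have := Real.log_two_lt_d9
  norm_num
  linarith

lemma candidates_fit {e D k P : ℕ} (he : 6 ≤ e) (hD : 0 < D) (hP : 0 < P)
    (hk : k * (e * D ^ 2 * P) ≤ n) :
    k * (D + 1) + (D + 1) ^ 2 * (k * P) ≤ n := by
  have h1 : k * (D + 1) ≤ k * P * (2 * D ^ 2) := by
    calc k * (D + 1) ≤ k * (2 * D ^ 2) := by gcongr; nlinarith
      _ = k * 1 * (2 * D ^ 2) := by ring
      _ ≤ k * P * (2 * D ^ 2) := by gcongr; exact hP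
  have h2 : (D + 1) ^ 2 * (k * P) ≤ (4 * D ^ 2) * (k * P) := by
    gcongr
    nlinarith
  calc _ ≤ k * P * (2 * D ^ 2) + (4 * D ^ 2) * (k * P) := add_le_add h1 h2
    _ = k * (6 * D ^ 2 * P) := by ring
    _ ≤ k * (e * D ^ 2 * P) := by gcongr
    _ ≤ n := hk

lemma reach_tail_step {H : SimpleGraph (Fin n)} {e D p x : ℕ} {α T : ℝ} (hn : 0 < n)
    (he : 8 ≤ e) (hD0 : 0 < D) (hD : ∀ v, #(nbrs H v) ≤ D) (hp : 100 ≤ p) (hα : 0 ≤ α)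
    (hk : ((n / (e * D ^ 2 * p ^ (4 * D)) : ℕ) : ℝ) ≤ Real.exp α * (x + 1))
    (hT : T ≤ (x + 1) * ((p : ℝ) / 4 - 1 - α)) (V : Finset (Fin n))
    (hV : #V ≤ n / (e * D ^ 2 * p ^ (4 * D))) (G : SimpleGraph (Fin n)) (hG : CopyOff H V G) :
    Reach ((D + 1) * (2 * D * (n / p + 1)))
      (((D + 1 : ℕ) : ℝ) * (((2 * D : ℕ) : ℝ) * Real.exp (-T))) G
      fun G' => ∃ Z : Finset (Fin n), #Z ≤ (D + 1) * (2 * D * x) ∧ CopyOff H Z G' := by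
  set k := n / (e * D ^ 2 * p ^ (4 * D)) with hkdef
  have hkn : k * (e * D ^ 2 * p ^ (4 * D)) ≤ n := Nat.div_mul_le_self _ _
  have hP : (p ^ 2) ^ (2 * D) = p ^ (4 * D) := by rw [← pow_mul]; congr 1; ring
  have hp0 : 0 < p := by omega
  have hpR : (100 : ℝ) ≤ p := by exact_mod_cast hp
  have hpR0 : (0 : ℝ) < p := by linarith
  have hlog : Real.log p ≤ p / 64 + 5 :=
    (log_le_div_add (c := 64) hpR0 (by norm_num)).trans (by linarith [log_sixty_four_le])
  have hlog0 : 0 ≤ Real.log p := Real.log_nonneg (by linarith)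
  have hmain : (p : ℝ) / 4 ≤ 1 / (2 * p) * (((p ^ 2 : ℕ) : ℝ) - 1) - 1 - 2 * Real.log p := by
    have h1 : (1 : ℝ) / (2 * p) * (((p ^ 2 : ℕ) : ℝ) - 1) = p / 2 - 1 / (2 * p) := by
      push_cast
      field_simp
    have h2 : (1 : ℝ) / (2 * p) ≤ 1 := by
      rw [div_le_one (by positivity)]
      linarith
    rw [h1]
    linarith
  have hphase := phase_halving hD k (p ^ 2) (2 * D) x (n / p + 1) le_rfl (by positivity)
    (Real.exp_pos (-T)).le (by
      rw [hP]
      exact candidates_fit (by omega) hD0 (by positivity) hkn) (by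
      rw [hP, Nat.le_div_iff_mul_le (by norm_num)]
      calc k * p ^ (4 * D) * 4 = k * (4 * 1 * p ^ (4 * D)) := by ring
        _ ≤ k * (e * D ^ 2 * p ^ (4 * D)) := by
          gcongr
          · omega
          · exact Nat.one_le_pow _ _ hD0
        _ ≤ n := hkn) (fun j _ => by
      refine (halving_prob_le (τ := 1 / (2 * p)) (β := 2 * Real.log p) hn hα (by linarith)
        (by positivity) hk ?_ ?_ (by positivity) (by linarith) j).trans ?_
      · rw [two_mul, Real.exp_add, Real.exp_log hpR0]
        push_cast
        exact (sq (p : ℝ)).le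
      · have h1 : (n : ℝ) / p ≤ ((n / p + 1 : ℕ) : ℝ) := by
          rw [div_le_iff₀ hpR0]
          have := (Nat.lt_mul_div_succ n hp0).le
          rw [mul_comm]
          exact_mod_cast this
        calc 2 * (1 / (2 * (p : ℝ))) * n = n / p := by field_simp
          _ ≤ _ := h1
      · gcongr
        have hx : (0 : ℝ) < x + 1 := by positivity
        nlinarith)
  refine (hphase.sweep (by positivity) (D + 1) ∅ V (fun u _ => ⟨nbrs H u,
    Nat.lt_succ_of_le (hD u), fun v _ _ h => mem_nbrs.2 h⟩) hV G (by simpa using hG)).mono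
    le_rfl le_rfl fun G' _ ⟨Z, hZ, h⟩ => ⟨Z, hZ, by simpa using h⟩

end TailStep

section Tail

open Finset
open scoped Classical

variable {n : ℕ}

lemma three_log_add_le {n e s : ℕ} (hn : 0 < n) (he : 10 ≤ e) (hen : e ^ 4 ≤ n) (hs : n ≤ s ^ 2) :
    3 * Real.log n + e ≤ s := by
  have h1 : e ^ 2 ≤ s := by
    by_contra! h
    have : s ^ 2 < (e ^ 2) ^ 2 := Nat.pow_lt_pow_left h two_ne_zero
    rw [← pow_mul, show 2 * 2 = 4 from rfl] at this
    omega
  have hs1 : 100 ≤ s := by nlinarith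
  have hsR : (100 : ℝ) ≤ s := by exact_mod_cast hs1
  have h2 : Real.log n ≤ 2 * Real.log s := by
    have := Real.log_le_log (x := (n : ℝ)) (y := (s : ℝ) ^ 2) (by exact_mod_cast hn)
      (by exact_mod_cast hs)
    rwa [Real.log_pow] at this
  have h3 := log_le_div_add (c := 64) (x := (s : ℝ)) (by linarith) (by norm_num)
  have h4 := log_sixty_four_le
  have h5 : (10 : ℝ) * e ≤ s := by
    have : 10 * e ≤ s := by nlinarith
    exact_mod_cast this
  linarith

lemma succ_mul_two_mul_le {D : ℕ} (hD : 0 < D) : (D + 1) * (2 * D) ≤ 4 * D ^ 2 := by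
  nlinarith

lemma mul_pow_le_two_mul_pow {e D p : ℕ} (hD : 2 ≤ D) (he : e ≤ D) (hp : D ≤ p) :
    e * D ^ 2 * ((D + 1) * (2 * D)) ≤ (2 * p) ^ (4 * D) := by
  calc e * D ^ 2 * ((D + 1) * (2 * D)) ≤ D * D ^ 2 * (4 * D ^ 2) :=
        Nat.mul_le_mul (Nat.mul_le_mul_right _ he) (succ_mul_two_mul_le (by omega))
    _ = 4 * D ^ 5 := by ring
    _ ≤ 32 * p ^ 5 := Nat.mul_le_mul (by norm_num) (Nat.pow_le_pow_left hp 5)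
    _ = (2 * p) ^ 5 := by ring
    _ ≤ (2 * p) ^ (4 * D) := Nat.pow_le_pow_right (by omega) (by omega)

lemma le_div_of_le_mul_log {e D p L : ℝ} (he : 10 ^ 6 ≤ e) (hlog : 10 ^ 5 * Real.log e ≤ e)
    (hD : D = e ^ 16) (hp : 10 ^ 6 * e * D ≤ p) (hL : L ≤ 16 * D * Real.log (2 * p)) :
    L ≤ p / 10 ^ 4 := by
  have he0 : 0 < e := by linarith
  have hD0 : 0 < D := hD ▸ by positivity
  have hp0 : 0 < p := lt_of_lt_of_le (by positivity) hp
  have hlog2 : Real.log (2 * p) ≤ 2 * p / e ^ 18 + 18 * Real.log e := by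
    have := log_le_div_add (x := 2 * p) (c := e ^ 18) (by positivity) (by positivity)
    rwa [Real.log_pow] at this
  have h1 : D * (2 * p / e ^ 18) ≤ p / 10 ^ 10 := by
    have h2 : D * (2 * p / e ^ 18) = 2 * p / e ^ 2 := by
      rw [hD]
      field_simp
    have h3 : 2 * 10 ^ 10 ≤ e ^ 2 := by nlinarith
    rw [h2, div_le_div_iff₀ (by positivity) (by positivity)]
    calc 2 * p * 10 ^ 10 = p * (2 * 10 ^ 10) := by ring
      _ ≤ p * e ^ 2 := mul_le_mul_of_nonneg_left h3 hp0.le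
  have h4 : D * (18 * Real.log e) ≤ p / 10 ^ 6 := by
    have h5 : 18 * Real.log e ≤ e := by
      have : 0 ≤ Real.log e := Real.log_nonneg (by linarith)
      linarith
    rw [le_div_iff₀ (by positivity)]
    calc D * (18 * Real.log e) * 10 ^ 6 ≤ D * e * 10 ^ 6 := by gcongr
      _ = 10 ^ 6 * e * D := by ring
      _ ≤ p := hp
  have h6 : D * Real.log (2 * p) ≤ D * (2 * p / e ^ 18) + D * (18 * Real.log e) := by
    rw [← mul_add]
    exact mul_le_mul_of_nonneg_left hlog2 hD0.le
  linarith

lemma reach_tail {H : SimpleGraph (Fin n)} {e : ℕ} (hn : 0 < n) (he : 10 ^ 6 ≤ e)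
    (hlog : 10 ^ 5 * Real.log e ≤ e) (hD : ∀ v, #(nbrs H v) ≤ e ^ 16) (f : ℕ) :
    ∀ p, e ^ 20 ≤ p → p ^ (16 * e ^ 16) ≤ n → n < p + f →
    ∀ V : Finset (Fin n), #V ≤ n / (e * (e ^ 16) ^ 2 * p ^ (4 * e ^ 16)) →
    ∀ G, CopyOff H V G → ∀ t, 16 * (e ^ 16) ^ 2 * n ≤ t * p →
    Reach t (f * (((e ^ 16 + 1 : ℕ) : ℝ) * (((2 * e ^ 16 : ℕ) : ℝ) *
      Real.exp (-(3 * Real.log n + e))))) G (CopyOff H ∅) := by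
  obtain ⟨D, hDdef⟩ : ∃ D, D = e ^ 16 := ⟨_, rfl⟩
  rw [← hDdef] at hD ⊢
  set T : ℝ := 3 * Real.log n + e with hT
  have he1 : 1 ≤ e := by omega
  have heD : e ≤ D := hDdef ▸ Nat.le_self_pow (by norm_num) e
  have hD0 : 0 < D := by omega
  induction f with
  | zero =>
    intro p hp hpn hnp
    have : p ≤ n := (Nat.le_self_pow (by omega) p).trans hpn
    omega
  | succ f ih =>
    intro p hp hpn hnp V hV G hG t ht
    have hpn' : p ≤ n := (Nat.le_self_pow (by omega) p).trans hpn
    have hpD : e ^ 4 * D ≤ p := by rw [hDdef, ← pow_add]; exact hp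
    have he4 : 10 ^ 6 * e ≤ e ^ 4 := by
      calc 10 ^ 6 * e ≤ e * e := by gcongr
        _ = e ^ 2 := (sq e).symm
        _ ≤ e ^ 4 := Nat.pow_le_pow_right he1 (by norm_num)
    have hpeD : 10 ^ 6 * e * D ≤ p := (Nat.mul_le_mul_right D he4).trans hpD
    have hp0 : 10 ^ 6 * e ≤ p := le_trans (by nlinarith) hpeD
    have htime : ((D + 1) * (2 * D * (n / p + 1))) * p ≤ 8 * D ^ 2 * n := by
      have h1 : (n / p + 1) * p ≤ 2 * n := by
        have := Nat.div_mul_le_self n p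
        rw [add_mul]
        omega
      calc ((D + 1) * (2 * D * (n / p + 1))) * p = ((D + 1) * (2 * D)) * ((n / p + 1) * p) := by ring
        _ ≤ (4 * D ^ 2) * (2 * n) := Nat.mul_le_mul (succ_mul_two_mul_le hD0) h1
        _ = 8 * D ^ 2 * n := by ring
    have htime' : (D + 1) * (2 * D * (n / p + 1)) ≤ t := by
      refine Nat.le_of_mul_le_mul_right (htime.trans (le_trans ?_ ht)) (by omega : 0 < p)
      gcongr
      norm_num
    have hpR : (10 : ℝ) ^ 6 * e * D ≤ p := by exact_mod_cast hpeD
    have heR : (10 : ℝ) ^ 6 ≤ e := by exact_mod_cast he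
    have hDR : (1 : ℝ) ≤ D := by exact_mod_cast hD0
    have hp0R : (10 : ℝ) ^ 6 * e ≤ p := by exact_mod_cast hp0
    have hpR0 : (0 : ℝ) < p := by linarith
    have hpR10 : (10 : ℝ) ^ 6 * D ≤ p := le_trans (by nlinarith) hpR
    by_cases hcase : (2 * p) ^ (16 * D) ≤ n
    · set m := (D + 1) * (2 * D) with hm
      set Y := e * D ^ 2 * (2 * p) ^ (4 * D) * m with hY
      have hDp : D ≤ p := le_trans (by nlinarith) hpeD
      have hm0 : 0 < m := by positivity
      have hY0 : 0 < Y := by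
        have : 0 < p := by omega
        positivity
      set x := n / Y with hx
      have hnx : n < Y * (x + 1) := Nat.lt_mul_div_succ n hY0
      have hmx : (D + 1) * (2 * D * x) ≤ n / (e * D ^ 2 * (2 * p) ^ (4 * D)) := by
        calc (D + 1) * (2 * D * x) = (n / (e * D ^ 2 * (2 * p) ^ (4 * D)) / m) * m := by
              rw [Nat.div_div_eq_div_mul, hx, hm]; ring
          _ ≤ _ := Nat.div_mul_le_self _ _
      have hYle : Y ≤ (2 * p) ^ (8 * D) := by
        calc Y = (2 * p) ^ (4 * D) * (e * D ^ 2 * m) := by rw [hY]; ring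
          _ ≤ (2 * p) ^ (4 * D) * (2 * p) ^ (4 * D) :=
            Nat.mul_le_mul_left _ (mul_pow_le_two_mul_pow (by omega) heD hDp)
          _ = (2 * p) ^ (8 * D) := by rw [← pow_add]; congr 1; ring
      have hYY : Y * Y ≤ n := by
        calc Y * Y ≤ (2 * p) ^ (8 * D) * (2 * p) ^ (8 * D) := Nat.mul_le_mul hYle hYle
          _ = (2 * p) ^ (16 * D) := by rw [← pow_add]; congr 1; ring
          _ ≤ n := hcase
      have hxY : Y < x + 1 := Nat.lt_of_mul_lt_mul_left (hYY.trans_lt hnx)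
      have hxT : T ≤ ((x + 1 : ℕ) : ℝ) := by
        refine three_log_add_le hn (by omega) ?_ ?_
        · calc e ^ 4 ≤ p ^ 4 := by
                gcongr
                omega
            _ ≤ p ^ (16 * D) := Nat.pow_le_pow_right (by omega) (by omega)
            _ ≤ n := hpn
        · rw [sq]
          exact hnx.le.trans (Nat.mul_le_mul_right _ hxY.le)
      have hα : Real.log ((2 ^ (4 * D) * m : ℕ) : ℝ) ≤ 8 * D := by
        push_cast
        have h2 := Real.log_two_lt_d9
        have h3 : Real.log (m : ℝ) ≤ 4 * D := by
          have h4 : (m : ℝ) ≤ (2 * D) ^ 2 := by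
            rw [hm]
            push_cast
            nlinarith
          have h5 := Real.log_le_log (by positivity) h4
          rw [Real.log_pow] at h5
          have h6 := Real.log_le_sub_one_of_pos (x := 2 * (D : ℝ)) (by positivity)
          push_cast at h5
          linarith
        rw [Real.log_mul (by positivity) (by positivity), Real.log_pow]
        push_cast
        nlinarith
      have hstep := reach_tail_step (x := x) (T := T)
        (α := Real.log ((2 ^ (4 * D) * m : ℕ) : ℝ)) hn (by omega) hD0 hD
        (by omega : 100 ≤ p) (Real.log_natCast_nonneg _) (by
          rw [Real.exp_log (by positivity)]
          have : n / (e * D ^ 2 * p ^ (4 * D)) ≤ (2 ^ (4 * D) * m) * (x + 1) := by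
            refine Nat.div_le_of_le_mul (hnx.le.trans (le_of_eq ?_))
            rw [hY]
            ring
          exact_mod_cast this) (by
          push_cast at hxT
          have : (0 : ℝ) ≤ x := Nat.cast_nonneg x
          nlinarith) V hV G hG
      have h := hstep.trans (t := t - (D + 1) * (2 * D * (n / p + 1)))
        (δ := f * (((D + 1 : ℕ) : ℝ) * (((2 * D : ℕ) : ℝ) * Real.exp (-T)))) (ℋ := CopyOff H ∅)
        (by positivity) (fun G' _ ⟨Z, hZ, hcopy⟩ => ih (2 * p) (by omega) hcase (by omega) Z
          (hZ.trans hmx) G' hcopy _ (by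
            rw [Nat.sub_mul]
            have h1 : ((D + 1) * (2 * D * (n / p + 1))) * (2 * p) ≤ 16 * D ^ 2 * n := by
              linarith
            have h2 : 32 * D ^ 2 * n ≤ t * (2 * p) := by linarith
            refine Nat.le_sub_of_add_le ?_
            linarith))
      refine h.mono (by omega) (le_of_eq ?_) fun _ _ h => h
      push_cast
      ring
    · have hL : Real.log n ≤ 16 * D * Real.log (2 * p) := by
        have h1 : (n : ℝ) ≤ (2 * p) ^ (16 * D) := by exact_mod_cast (not_le.1 hcase).le
        have := Real.log_le_log (by exact_mod_cast hn) h1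
        rw [Real.log_pow] at this
        push_cast at this
        exact this
      have hL' : Real.log n ≤ p / 10 ^ 4 :=
        le_div_of_le_mul_log heR hlog (by exact_mod_cast hDdef) hpR hL
      have hstep := reach_tail_step (x := 0) (T := T) (α := Real.log n) hn (by omega) hD0 hD
        (by omega : 100 ≤ p) (Real.log_natCast_nonneg _) (by
          rw [Real.exp_log (by positivity)]
          push_cast
          have : n / (e * D ^ 2 * p ^ (4 * D)) ≤ n := Nat.div_le_self _ _
          rw [zero_add, mul_one]
          exact_mod_cast this) (by
          push_cast
          rw [hT]
          linarith) V hV G hG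
      refine hstep.mono htime' ?_ fun G' _ ⟨Z, hZ, h⟩ => ?_
      · refine le_mul_of_one_le_left (by positivity) ?_
        push_cast
        linarith [(Nat.cast_nonneg f : (0 : ℝ) ≤ f)]
      · rw [mul_zero, mul_zero, Nat.le_zero, card_eq_zero] at hZ
        exact hZ ▸ h

end Tail

section Assembly

open Finset
open scoped Classical

variable {n : ℕ}

lemma crowd_prob_le_exp_neg {e k x m h s t : ℕ} {α T : ℝ} (hn : 0 < n) (he : 10 ^ 6 ≤ e)
    (hlog : 10 ^ 5 * Real.log e ≤ e) (hα : 0 ≤ α) (hk : (k : ℝ) ≤ Real.exp α * (x + 1))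
    (hm : m ≤ e ^ 48 * h) (hs : e ≤ s) (ht : s * n ≤ t)
    (hT : T ≤ (x + 1) * (h * s / 4 - 1 - α)) :
    (k.choose (x + 1) : ℝ) * ((x + 1) * m).choose ((x + 1) * h) *
      Real.exp (-(t : ℝ) / (2 * n)) ^ ((x + 1) * h) ≤ Real.exp (-T) := by
  have heR : (10 : ℝ) ^ 6 ≤ e := by exact_mod_cast he
  have hsR : (e : ℝ) ≤ s := by exact_mod_cast hs
  have he0 : (0 : ℝ) < e := by linarith
  have hℓ : 0 ≤ Real.log e := Real.log_natCast_nonneg _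
  refine (crowd_prob_le (τ := s / 2) (β := 48 * Real.log e) hn hα (by linarith) hk ?_ ?_).trans ?_
  · rw [show 48 * Real.log (e : ℝ) = Real.log ((e : ℝ) ^ 48) by rw [Real.log_pow]; norm_num,
      Real.exp_log (by positivity)]
    exact_mod_cast hm
  · calc 2 * ((s : ℝ) / 2) * n = ((s * n : ℕ) : ℝ) := by push_cast; ring
      _ ≤ t := by exact_mod_cast ht
  · have h1 : (s : ℝ) / 4 ≤ s / 2 - 1 - 48 * Real.log e := by linarith
    have h2 : (h : ℝ) * s / 4 ≤ h * ((s : ℝ) / 2 - 1 - 48 * Real.log e) := by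
      rw [mul_div_assoc]
      gcongr
    have h3 : (0 : ℝ) ≤ x + 1 := by positivity
    rw [Real.exp_le_exp]
    nlinarith

lemma reach_few_missing {H : SimpleGraph (Fin n)} {e : ℕ} (hn : 0 < n) (he : 10 ^ 6 ≤ e)
    (hD : ∀ v, #(nbrs H v) ≤ e ^ 16) :
    Reach (e ^ 16 * n / 2) (Real.exp (-(3 * Real.log n + e))) ⊥
      fun G => #(missing (edges H) G) ≤ e ^ 9 * n := by
  refine (reach_greedy (edges H) (fun _ h => not_isDiag_of_mem_edges _ h) hn (e ^ 9)
    (e ^ 16 * n / 2) ⊥).mono le_rfl ?_ fun _ _ h => h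
  have hcard : #(missing (edges H) ⊥) ≤ e ^ 16 * n / 2 := by
    have h1 := card_le_card (missing_subset (edges H) ⊥)
    have h2 := two_mul_card_edges_le hD
    rw [mul_comm n] at h2
    omega
  have hn1 : (1 : ℝ) ≤ n := by exact_mod_cast hn
  have heR : (10 : ℝ) ^ 6 ≤ e := by exact_mod_cast he
  have ht : ((e ^ 16 * n / 2 : ℕ) : ℝ) ≤ (e : ℝ) ^ 16 * n / 2 := by
    have : 2 * (e ^ 16 * n / 2) ≤ e ^ 16 * n := Nat.mul_div_le _ _
    have : (2 : ℝ) * ((e ^ 16 * n / 2 : ℕ) : ℝ) ≤ (e : ℝ) ^ 16 * n := by exact_mod_cast this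
    linarith
  have hL : Real.log n ≤ n := (Real.log_le_sub_one_of_pos (by linarith)).trans (by linarith)
  have hcardR : ((#(missing (edges H) ⊥) : ℕ) : ℝ) ≤ ((e ^ 16 * n / 2 : ℕ) : ℝ) := by
    exact_mod_cast hcard
  have he9 : (1 : ℝ) ≤ (e : ℝ) ^ 9 := one_le_pow₀ (by linarith)
  have h16 : (e : ℝ) ^ 16 + 3 + e ≤ (e : ℝ) ^ 18 := by
    have h1 : (e : ℝ) ≤ e ^ 16 := le_self_pow₀ (by linarith) (by norm_num)
    have h2 : (e : ℝ) ^ 18 = e ^ 16 * (e * e) := by ring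
    have h3 : (e : ℝ) ^ 16 * 3 ≤ e ^ 16 * (e * e) := by
      gcongr
      nlinarith
    linarith
  have h18 : ((e : ℝ) ^ 16 + 3 + e) * n ≤ (e : ℝ) ^ 18 * n := by gcongr
  have h3 : (e : ℝ) ≤ e * n := le_mul_of_one_le_right (by linarith) hn1
  have h4 : (e : ℝ) ^ 9 * #(missing (edges H) ⊥) ≤ (e : ℝ) ^ 9 * ((e ^ 16 * n / 2 : ℕ) : ℝ) := by
    gcongr
  have h5 : (0 : ℝ) ≤ (e : ℝ) ^ 16 * n := by positivity
  rw [Real.exp_le_exp, Nat.cast_pow]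
  have h6 : (e : ℝ) ^ 9 * (e : ℝ) ^ 9 * n = (e : ℝ) ^ 18 * n := by ring
  linarith

lemma reach_sparse {H : SimpleGraph (Fin n)} {e : ℕ} (hn : 4 ≤ n) (he : 10 ^ 6 ≤ e)
    (hlog : 10 ^ 5 * Real.log e ≤ e) (G : SimpleGraph (Fin n))
    (hG : #(missing (edges H) G) ≤ e ^ 9 * n) :
    Reach (8 * e ^ 9 * (e ^ 5 * n)) (Real.exp (-(3 * Real.log n + e))) G
      fun G => #(missing (edges H) G) ≤ n / e ^ 39 := by
  have he0 : 0 < e := by omega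
  have hlt : n < e ^ 39 * (n / e ^ 39 + 1) := Nat.lt_mul_div_succ n (by positivity)
  refine (reach_crowd {()} (fun _ => missing (edges H) G) (missing (edges H) G)
    (fun a ha => not_isDiag_of_mem_edges _ (missing_subset _ _ ha)) (8 * e ^ 9) ?_
    (fun _ _ => Subset.rfl) (e ^ 9 * n) (fun _ _ => hG) (n / e ^ 39 + 1) 0 (e ^ 5 * n) 1 1
    (fun _ _ => ⟨∅, by simp, fun v _ h => absurd (Subsingleton.elim _ _) h⟩) (by simp) G).mono
    le_rfl ?_ fun G' hGG' h => ?_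
  · refine hG.trans ?_
    rw [mul_comm 8, mul_assoc]
    exact Nat.mul_le_mul_left _ (by omega)
  · refine crowd_prob_le_exp_neg (s := e ^ 5) (α := 0) (by omega) he hlog le_rfl (by simp) ?_
      (Nat.le_self_pow (by norm_num) e) le_rfl ?_
    · calc e ^ 9 * n ≤ e ^ 9 * (e ^ 39 * (n / e ^ 39 + 1)) := Nat.mul_le_mul_left _ hlt.le
        _ = e ^ 48 * (n / e ^ 39 + 1) := by ring
    · generalize n / e ^ 39 + 1 = h at hlt
      have hh : 0 < h := by
        by_contra! h0
        obtain rfl : h = 0 := by omega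
        omega
      have hhR : (1 : ℝ) ≤ h := by exact_mod_cast hh
      have heR : (10 : ℝ) ^ 6 ≤ e := by exact_mod_cast he
      have h1 : Real.log n ≤ 39 * Real.log e + Real.log h := by
        have h2 : (n : ℝ) ≤ (e : ℝ) ^ 39 * h := by exact_mod_cast hlt.le
        have h3 := Real.log_le_log (by exact_mod_cast (by omega : 0 < n)) h2
        rw [Real.log_mul (by positivity) (by positivity), Real.log_pow] at h3
        exact_mod_cast h3
      have h4 : Real.log h ≤ h := (Real.log_le_sub_one_of_pos (by linarith)).trans (by linarith)
      have h5 : (20 : ℝ) * e ≤ e ^ 5 := by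
        have : (e : ℝ) * e ≤ e ^ 5 := by
          rw [← sq]
          exact pow_le_pow_right₀ (by linarith) (by norm_num)
        nlinarith
      have h6 : (h : ℝ) * (20 * e) ≤ h * e ^ 5 := by gcongr
      have h7 : (e : ℝ) ≤ h * e := le_mul_of_one_le_left (by linarith) hhR
      have h8 : (h : ℝ) * 10 ^ 6 ≤ h * e := by gcongr
      push_cast
      linarith
  · simp only [Nat.mul_zero, Nat.le_zero, card_eq_zero, filter_eq_empty_iff, mem_singleton,
      forall_const, not_le] at h
    have h1 : missing (edges H) G' ⊆ missing (missing (edges H) G) G' := by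
      intro a ha
      rw [mem_missing] at ha ⊢
      refine ⟨mem_missing.2 ⟨ha.1, fun h2 => ha.2 (SimpleGraph.edgeSet_mono hGG' h2)⟩, ha.2⟩
    exact (card_le_card h1).trans (Nat.lt_succ_iff.1 h)

lemma reach_copyOff_of_sparse {H : SimpleGraph (Fin n)} {e D x : ℕ} {α T : ℝ} (hn : 4 ≤ n)
    (he : 10 ^ 6 ≤ e) (hlog : 10 ^ 5 * Real.log e ≤ e) (hDe : D = e ^ 16)
    (hD : ∀ v, #(nbrs H v) ≤ D) (hα : 0 ≤ α) (hx : (n : ℝ) ≤ Real.exp α * (x + 1))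
    (hT : T ≤ (x + 1) * ((e : ℝ) ^ 17 / 4 - 1 - α)) (G : SimpleGraph (Fin n))
    (hG : #(missing (edges H) G) ≤ n / e ^ 39) :
    Reach (2 * e ^ 14 * n) (((e ^ 3 + 1 : ℕ) : ℝ) * Real.exp (-T)) G
      fun G => ∃ Z : Finset (Fin n), #Z ≤ 2 * (D * D + 1) * x ∧ CopyOff H Z G := by
  have he1 : 1 ≤ e := by omega
  have hpow {i j : ℕ} (h : i ≤ j) : e ^ i ≤ e ^ j := Nat.pow_le_pow_right he1 h
  have hD0 : 0 < D := hDe ▸ by positivity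
  set k := n / e ^ 39 with hk
  have hkn : k * (e * D ^ 2 * e ^ 6) ≤ n := by
    rw [hDe, show e * (e ^ 16) ^ 2 * e ^ 6 = e ^ 39 by ring]
    exact Nat.div_mul_le_self _ _
  have hkn4 : k ≤ n / 4 :=
    Nat.div_le_div_left (le_trans (by omega) (Nat.le_self_pow (by norm_num) e)) (by norm_num)
  have hkx : (k : ℝ) ≤ Real.exp α * (x + 1) :=
    le_trans (by exact_mod_cast Nat.div_le_self _ _) hx
  have hcover := reach_cover hD k (e ^ 3) x (e ^ 14 * n) G hG hkn4
  have hphase := phase_stars hD k (e ^ 6) x (e ^ 11 * n)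
    (candidates_fit (by omega) hD0 (by positivity) hkn) (by
      rw [Nat.le_div_iff_mul_le (by norm_num)]
      calc k * (e ^ 6 * (2 * D)) * 4 = k * (8 * D * e ^ 6) := by ring
        _ ≤ k * (e * D ^ 2 * e ^ 6) := by
          refine Nat.mul_le_mul_left _ (Nat.mul_le_mul_right _ (Nat.mul_le_mul (by omega) ?_))
          exact Nat.le_self_pow two_ne_zero D
        _ ≤ n := hkn)
  have h := hcover.trans (t := e ^ 3 * (e ^ 11 * n)) (δ := (e ^ 3 : ℕ) * Real.exp (-T))
    (ℋ := fun G => ∃ Z : Finset (Fin n), #Z ≤ 2 * (D * D + 1) * x ∧ CopyOff H Z G)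
    (by positivity) fun G' _ ⟨W, V, hW, hV, hVN, hcopy⟩ => by
      refine (hphase.sweep (by positivity) (e ^ 3) W V hVN hV G' hcopy).mono le_rfl ?_
        fun G'' _ ⟨Z, hZ, hcopy'⟩ => ⟨W ∪ Z, (card_union_le _ _).trans ?_, hcopy'⟩
      · refine mul_le_mul_of_nonneg_left ?_ (by positivity)
        refine crowd_prob_le_exp_neg (s := e ^ 11) (by omega) he hlog hα hkx ?_
          (Nat.le_self_pow (by norm_num) e) le_rfl ?_
        · calc e ^ 6 * (2 * D) ≤ e ^ 6 * (e * e ^ 16) :=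
                Nat.mul_le_mul_left _ (Nat.mul_le_mul (by omega) hDe.le)
            _ = e ^ 17 * e ^ 6 := by ring
            _ ≤ e ^ 48 * e ^ 6 := Nat.mul_le_mul_right _ (hpow (by norm_num))
        · convert hT using 5
          push_cast
          ring
      · have h1 : e ^ 3 ≤ D * D + 1 := by
          rw [hDe, ← pow_add]
          exact (hpow (by norm_num)).trans (Nat.le_succ _)
        have h2 : e ^ 3 * x ≤ (D * D + 1) * x := Nat.mul_le_mul_right _ h1
        linarith
  refine h.mono (le_of_eq (by ring)) ?_ fun _ _ h => h
  have hfail := crowd_prob_le_exp_neg (n := n) (s := e ^ 14) (k := n) (x := x) (m := D * D) (h := e ^ 3)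
    (T := T) (by omega) he hlog hα hx (by
      calc D * D = e ^ 32 := by rw [hDe, ← pow_add]
        _ ≤ e ^ 51 := hpow (by norm_num)
        _ = e ^ 48 * e ^ 3 := by rw [← pow_add])
    (Nat.le_self_pow (by norm_num) e) le_rfl (by
      convert hT using 5
      push_cast
      ring)
  push_cast at hfail ⊢
  linarith

lemma succ_pow_le {e D X : ℕ} (he : 10 ^ 6 ≤ e) (hDe : D = e ^ 16)
    (hX : X = e * D ^ 2 * (e ^ 20) ^ (4 * D)) : X * (2 * (D * D + 1)) ≤ e ^ (81 * D) := by
  have he1 : 1 ≤ e := by omega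
  have heD : e ≤ D := hDe ▸ Nat.le_self_pow (by norm_num) e
  have h1 : 2 * (D * D + 1) ≤ e ^ 33 := by
    have h2 : D * D = e ^ 32 := by rw [hDe, ← pow_add]
    have h3 : 1 ≤ e ^ 32 := Nat.one_le_pow _ _ he1
    rw [h2, pow_succ e 32]
    nlinarith
  calc X * (2 * (D * D + 1)) ≤ (e * D ^ 2 * (e ^ 20) ^ (4 * D)) * e ^ 33 := by
        rw [hX]
        exact Nat.mul_le_mul_left _ h1
    _ = e ^ (66 + 80 * D) := by
        rw [← pow_mul, show 20 * (4 * D) = 80 * D by ring,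
          show e * D ^ 2 = e ^ 33 by rw [hDe, ← pow_mul]; ring, pow_add]
        ring
    _ ≤ e ^ (81 * D) := Nat.pow_le_pow_right he1 (by omega)

lemma mul_log_le {e D : ℕ} (hlog : 10 ^ 5 * Real.log e ≤ e) (hDe : D = e ^ 16) (c : ℝ)
    (hc : 0 ≤ c) : c * D * Real.log e ≤ c * (e : ℝ) ^ 17 / 10 ^ 5 := by
  have h1 : (D : ℝ) = (e : ℝ) ^ 16 := by exact_mod_cast hDe
  rw [h1]
  calc c * (e : ℝ) ^ 16 * Real.log e = c * (e : ℝ) ^ 16 * (10 ^ 5 * Real.log e) / 10 ^ 5 := by ring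
    _ ≤ c * (e : ℝ) ^ 16 * e / 10 ^ 5 := by gcongr
    _ = c * (e : ℝ) ^ 17 / 10 ^ 5 := by ring

lemma reach_copy_of_sparse {H : SimpleGraph (Fin n)} {e D : ℕ} (hn : 4 ≤ n)
    (he : 10 ^ 6 ≤ e) (hlog : 10 ^ 5 * Real.log e ≤ e) (hDe : D = e ^ 16)
    (hD : ∀ v, #(nbrs H v) ≤ D) (G : SimpleGraph (Fin n))
    (hG : #(missing (edges H) G) ≤ n / e ^ 39) :
    Reach (2 * e ^ 14 * n + 16 * e ^ 12 * n)
      ((((e ^ 3 + 1 : ℕ) : ℝ) + n * (((D + 1 : ℕ) : ℝ) * ((2 * D : ℕ) : ℝ))) *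
        Real.exp (-(3 * Real.log n + e))) G (CopyOff H ∅) := by
  have he1 : 1 ≤ e := by omega
  have hn0 : 0 < n := by omega
  have hD0 : 0 < D := hDe ▸ by positivity
  have heR : (10 : ℝ) ^ 6 ≤ e := by exact_mod_cast he
  have he17 : (10 : ℝ) ^ 6 * e ≤ e ^ 17 := by
    calc (10 : ℝ) ^ 6 * e ≤ e * e := by gcongr
      _ = e ^ 2 := (sq _).symm
      _ ≤ e ^ 17 := pow_le_pow_right₀ (by linarith) (by norm_num)
  rw [add_mul]
  by_cases hcase : e ^ (320 * D) ≤ n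
  · set X := e * D ^ 2 * (e ^ 20) ^ (4 * D) with hX
    set Y := X * (2 * (D * D + 1)) with hY
    have hY0 : 0 < Y := by positivity
    have hYle : Y ≤ e ^ (81 * D) := succ_pow_le he hDe hX
    have hnx : n < Y * (n / Y + 1) := Nat.lt_mul_div_succ n hY0
    have hYY : Y * Y ≤ n := by
      calc Y * Y ≤ e ^ (81 * D) * e ^ (81 * D) := Nat.mul_le_mul hYle hYle
        _ = e ^ (162 * D) := by rw [← pow_add]; congr 1; ring
        _ ≤ e ^ (320 * D) := Nat.pow_le_pow_right he1 (by omega)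
        _ ≤ n := hcase
    have hxY : Y < n / Y + 1 := Nat.lt_of_mul_lt_mul_left (hYY.trans_lt hnx)
    have hxT : 3 * Real.log n + e ≤ ((n / Y + 1 : ℕ) : ℝ) := by
      refine three_log_add_le hn0 (by omega) ?_ ?_
      · exact (Nat.pow_le_pow_right he1 (by omega)).trans hcase
      · rw [sq]
        exact hnx.le.trans (Nat.mul_le_mul_right _ hxY.le)
    have hα : Real.log Y ≤ 81 * (e : ℝ) ^ 17 / 10 ^ 5 := by
      refine le_trans ?_ (mul_log_le hlog hDe 81 (by norm_num))
      have h1 : (Y : ℝ) ≤ (e : ℝ) ^ (81 * D) := by exact_mod_cast hYle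
      have h2 := Real.log_le_log (by exact_mod_cast hY0) h1
      rw [Real.log_pow] at h2
      exact_mod_cast h2
    have hYR : (0 : ℝ) < Y := by exact_mod_cast hY0
    have h := (reach_copyOff_of_sparse (x := n / Y) (α := Real.log Y)
      (T := 3 * Real.log n + e) hn he hlog hDe hD (Real.log_natCast_nonneg _)
      (by
        rw [Real.exp_log hYR]
        exact_mod_cast hnx.le)
      (by
        push_cast at hxT
        refine hxT.trans (le_mul_of_one_le_right (by positivity) ?_)
        linarith) G hG).trans (t := 16 * e ^ 12 * n)
      (δ := n * (((D + 1 : ℕ) : ℝ) * (((2 * D : ℕ) : ℝ) *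
        Real.exp (-(3 * Real.log n + e))))) (ℋ := CopyOff H ∅) (by positivity)
      fun G' _ ⟨Z, hZ, hcopy⟩ => by
        have := reach_tail hn0 he hlog (hDe ▸ hD) n (e ^ 20) le_rfl (by
            rw [← hDe, ← pow_mul, show 20 * (16 * D) = 320 * D by ring]
            exact hcase)
          (Nat.lt_add_of_pos_left (by positivity)) Z (by
            rw [← hDe]
            refine hZ.trans ?_
            rw [hY, ← Nat.div_div_eq_div_mul]
            exact Nat.mul_div_le _ _) G' hcopy (16 * e ^ 12 * n) (le_of_eq (by ring))
        rwa [← hDe] at this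
    exact h.mono le_rfl (le_of_eq (by ring)) fun _ _ h => h
  · have hL : Real.log n ≤ 320 * (e : ℝ) ^ 17 / 10 ^ 5 := by
      refine le_trans ?_ (mul_log_le hlog hDe 320 (by norm_num))
      have h1 : (n : ℝ) ≤ (e : ℝ) ^ (320 * D) := by exact_mod_cast (not_le.1 hcase).le
      have h2 := Real.log_le_log (by exact_mod_cast hn0) h1
      rw [Real.log_pow] at h2
      exact_mod_cast h2
    have hnR : (0 : ℝ) < n := by exact_mod_cast hn0
    refine (reach_copyOff_of_sparse (x := 0) (α := Real.log n)
      (T := 3 * Real.log n + e) hn he hlog hDe hD (Real.log_natCast_nonneg _)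
      (by
        rw [Real.exp_log hnR]
        simp)
      (by
        push_cast
        linarith) G hG).mono (by omega) ?_ fun _ _ ⟨Z, hZ, h⟩ => ?_
    · exact le_add_of_nonneg_right (by positivity)
    · rw [mul_zero, Nat.le_zero, card_eq_zero] at hZ
      exact hZ ▸ h

lemma poly_mul_exp_neg_le {e D : ℕ} (hn : 0 < n) (he : 10 ^ 6 ≤ e)
    (hlog : 10 ^ 5 * Real.log e ≤ e) (hDe : D = e ^ 16) :
    (((e ^ 3 + 3 : ℕ) : ℝ) + n * (((D + 1 : ℕ) : ℝ) * ((2 * D : ℕ) : ℝ))) *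
      Real.exp (-(3 * Real.log n + e)) ≤ 2 / n := by
  have he1 : 1 ≤ e := by omega
  have hn1 : (1 : ℝ) ≤ n := by exact_mod_cast hn
  have heR : (10 : ℝ) ^ 6 ≤ e := by exact_mod_cast he
  have h1 : (((e ^ 3 + 3 : ℕ) : ℝ) + n * (((D + 1 : ℕ) : ℝ) * ((2 * D : ℕ) : ℝ))) ≤
      2 * n * (e : ℝ) ^ 34 := by
    have h2 : e ^ 3 + 3 ≤ e ^ 34 := by
      have h3 : e ^ 3 * 4 ≤ e ^ 3 * e ^ 31 :=
        Nat.mul_le_mul_left _ (le_trans (by omega) (Nat.le_self_pow (by norm_num) e))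
      have h4 : 1 ≤ e ^ 3 := Nat.one_le_pow _ _ he1
      rw [← pow_add, show 3 + 31 = 34 from rfl] at h3
      omega
    have h5 : (D + 1) * (2 * D) ≤ e ^ 34 := by
      refine (succ_mul_two_mul_le (hDe ▸ by positivity)).trans ?_
      calc 4 * D ^ 2 ≤ e ^ 2 * D ^ 2 := by
            refine Nat.mul_le_mul_right _ (le_trans (by omega) (Nat.le_self_pow two_ne_zero e))
        _ = e ^ 34 := by rw [hDe]; ring
    have h2' : ((e ^ 3 + 3 : ℕ) : ℝ) ≤ (e : ℝ) ^ 34 := by exact_mod_cast h2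
    have h5' : ((D + 1 : ℕ) : ℝ) * ((2 * D : ℕ) : ℝ) ≤ (e : ℝ) ^ 34 := by exact_mod_cast h5
    have h6 : (n : ℝ) * (((D + 1 : ℕ) : ℝ) * ((2 * D : ℕ) : ℝ)) ≤ n * (e : ℝ) ^ 34 := by gcongr
    have h7 : (e : ℝ) ^ 34 ≤ n * (e : ℝ) ^ 34 := le_mul_of_one_le_left (by positivity) hn1
    linarith
  have h8 : (e : ℝ) ^ 34 * Real.exp (-e) ≤ 1 := by
    rw [← Real.exp_log (by positivity : (0 : ℝ) < (e : ℝ) ^ 34), ← Real.exp_add,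
      Real.exp_le_one_iff, Real.log_pow]
    have : 0 ≤ Real.log e := Real.log_natCast_nonneg _
    push_cast
    linarith
  have h9 : Real.exp (-(3 * Real.log n)) = 1 / (n : ℝ) ^ 3 := by
    rw [show 3 * Real.log (n : ℝ) = Real.log ((n : ℝ) ^ 3) by rw [Real.log_pow]; norm_num,
      Real.exp_neg, Real.exp_log (by positivity), one_div]
  calc _ ≤ 2 * n * (e : ℝ) ^ 34 * Real.exp (-(3 * Real.log n + e)) := by gcongr
    _ = 2 * n * (1 / (n : ℝ) ^ 3) * ((e : ℝ) ^ 34 * Real.exp (-e)) := by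
        rw [neg_add, Real.exp_add, h9]
        ring
    _ ≤ 2 * n * (1 / (n : ℝ) ^ 3) * 1 := by gcongr
    _ = 2 / (n : ℝ) ^ 2 := by field_simp
    _ ≤ 2 / n := by
        gcongr
        exact le_self_pow₀ hn1 two_ne_zero

theorem reach_containsCopy {H : SimpleGraph (Fin n)} {e : ℕ} (hn : 4 ≤ n)
    (he : 10 ^ 6 ≤ e) (hlog : 10 ^ 5 * Real.log e ≤ e) (hD : ∀ v, #(nbrs H v) ≤ e ^ 16) :
    Reach (e ^ 16 * n / 2 + e ^ 15 * n) (2 / n) ⊥ fun G => ContainsCopy G H := by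
  have hn0 : 0 < n := by omega
  obtain ⟨D, hDe⟩ : ∃ D, D = e ^ 16 := ⟨_, rfl⟩
  have h := (reach_few_missing hn0 he hD).trans (by positivity) fun G _ hG =>
    (reach_sparse hn he hlog G hG).trans (by positivity) fun G' _ hG' =>
      reach_copy_of_sparse hn he hlog hDe (hDe ▸ hD) G' hG'
  refine h.mono ?_ ?_ fun _ _ h => h.containsCopy
  · have h1 : 8 * e ^ 9 * (e ^ 5 * n) + (2 * e ^ 14 * n + 16 * e ^ 12 * n) ≤ e ^ 15 * n := by
      have h2 : e ^ 12 * n ≤ e ^ 14 * n :=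
        Nat.mul_le_mul_right _ (Nat.pow_le_pow_right (by omega) (by norm_num))
      have h3 : 26 * (e ^ 14 * n) ≤ e * (e ^ 14 * n) := Nat.mul_le_mul_right _ (by omega)
      calc 8 * e ^ 9 * (e ^ 5 * n) + (2 * e ^ 14 * n + 16 * e ^ 12 * n) =
            10 * (e ^ 14 * n) + 16 * (e ^ 12 * n) := by ring
        _ ≤ 26 * (e ^ 14 * n) := by linarith
        _ ≤ e * (e ^ 14 * n) := h3
        _ = e ^ 15 * n := by ring
    exact Nat.add_le_add_left h1 _
  · refine le_trans (le_of_eq ?_) (poly_mul_exp_neg_le hn0 he hlog hDe)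
    push_cast
    ring

end Assembly

section Rate

/-- A natural number exceeding the sixteenth root of `D` by a large constant. -/
noncomputable def rootBound (D : ℕ) : ℕ := ⌈(D : ℝ) ^ (1 / 16 : ℝ)⌉₊ + 10 ^ 11

/-- The relative number of rounds that are needed beyond the trivial lower bound. -/
noncomputable def excess (D : ℕ) : ℝ :=
  if D = 0 then 0 else ((rootBound D : ℝ) ^ 16 + 2 * (rootBound D : ℝ) ^ 15) / D - 1

lemma rpow_one_div_sixteen_pow (D : ℕ) : ((D : ℝ) ^ (1 / 16 : ℝ)) ^ 16 = D := by
  rw [← Real.rpow_natCast, ← Real.rpow_mul (Nat.cast_nonneg D)]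
  norm_num

lemma le_rootBound_pow (D : ℕ) : D ≤ rootBound D ^ 16 := by
  have h1 : (D : ℝ) ^ (1 / 16 : ℝ) ≤ rootBound D := by
    refine (Nat.le_ceil _).trans ?_
    exact_mod_cast Nat.le_add_right _ _
  have h2 := pow_le_pow_left₀ (by positivity) h1 16
  rw [rpow_one_div_sixteen_pow] at h2
  exact_mod_cast h2

lemma log_rootBound_le (D : ℕ) : 10 ^ 5 * Real.log (rootBound D) ≤ rootBound D := by
  have h1 : (10 : ℝ) ^ 11 ≤ rootBound D := by
    exact_mod_cast Nat.le_add_left _ _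
  have h2 := log_le_div_add (x := (rootBound D : ℝ)) (c := 200000) (by linarith) (by norm_num)
  have h3 := Real.log_le_sub_one_of_pos (x := 200000) (by norm_num)
  linarith

lemma excess_nonneg (D : ℕ) : 0 ≤ excess D := by
  unfold excess
  split_ifs with h
  · exact le_rfl
  · have hD : (0 : ℝ) < D := by exact_mod_cast Nat.pos_of_ne_zero h
    have h1 : (D : ℝ) ≤ (rootBound D : ℝ) ^ 16 := by exact_mod_cast le_rootBound_pow D
    rw [sub_nonneg, one_le_div hD]
    exact h1.trans (le_add_of_nonneg_right (by positivity))

lemma tendsto_excess : Tendsto excess atTop (nhds 0) := by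
  have hs : Tendsto (fun D : ℕ => ((D : ℝ) ^ (1 / 16 : ℝ))⁻¹) atTop (nhds 0) :=
    ((tendsto_rpow_atTop (by norm_num)).comp tendsto_natCast_atTop_atTop).inv_tendsto_atTop
  set C : ℝ := 10 ^ 11 + 1 with hC
  have hpoly : Tendsto (fun u : ℝ => (1 + C * u) ^ 16 + 2 * (1 + C * u) ^ 15 * u - 1) (nhds 0)
      (nhds 0) := by
    have : Continuous fun u : ℝ => (1 + C * u) ^ 16 + 2 * (1 + C * u) ^ 15 * u - 1 := by fun_prop
    convert this.tendsto 0 using 2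
    norm_num
  refine tendsto_of_tendsto_of_tendsto_of_le_of_le' tendsto_const_nhds (hpoly.comp hs)
    (Eventually.of_forall excess_nonneg) ?_
  filter_upwards [eventually_gt_atTop 0] with D hD
  have hDR : (0 : ℝ) < D := by exact_mod_cast hD
  set s : ℝ := (D : ℝ) ^ (1 / 16 : ℝ) with hs
  have hs0 : 0 < s := by positivity
  have hsD : s ^ 16 = D := rpow_one_div_sixteen_pow D
  have he : (rootBound D : ℝ) ≤ s * (1 + C * s⁻¹) := by
    have h1 := (Nat.ceil_lt_add_one hs0.le).le
    have h2 : s * (1 + C * s⁻¹) = s + C := by field_simp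
    rw [h2, rootBound, hC]
    push_cast
    linarith
  have hv : 0 ≤ 1 + C * s⁻¹ := by positivity
  rw [excess, if_neg hD.ne', Function.comp_apply, sub_le_sub_iff_right, div_le_iff₀ hDR]
  calc (rootBound D : ℝ) ^ 16 + 2 * (rootBound D : ℝ) ^ 15
      ≤ (s * (1 + C * s⁻¹)) ^ 16 + 2 * (s * (1 + C * s⁻¹)) ^ 15 := by gcongr
    _ = ((1 + C * s⁻¹) ^ 16 + 2 * (1 + C * s⁻¹) ^ 15 * s⁻¹) * s ^ 16 := by
        generalize 1 + C * s⁻¹ = v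
        field_simp
    _ = _ := by rw [hsD]

end Rate

lemma card_nbrs {n : ℕ} (H : SimpleGraph (Fin n)) (v : Fin n) :
    (nbrs H v).card = (H.neighborSet v).ncard := by
  rw [← Set.ncard_coe_finset]
  congr 1
  ext y
  simp

lemma exists_strategy_treeProb {n D : ℕ} (hn : 4 ≤ n) (H : SimpleGraph (Fin n))
    (hD : ∀ v : Fin n, (H.neighborSet v).ncard ≤ D) :
    ∃ σ : TreeStrategy n,
      1 - 2 / (n : ℝ) ≤ treeProb n ⌈(1 + excess D) * (D : ℝ) * (n : ℝ) / 2⌉₊ σ H := by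
  refine Reach.exists_strategy (by omega) ?_
  obtain rfl | hD0 := Nat.eq_zero_or_pos D
  · refine (Reach.of_mem ⟨id, Function.injective_id, fun u v h => ?_⟩).mono (Nat.zero_le _)
      (by positivity) fun _ _ h => h
    have h1 := hD u
    rw [← card_nbrs, Nat.le_zero, Finset.card_eq_zero] at h1
    exact absurd (mem_nbrs.2 h) (h1 ▸ Finset.notMem_empty v)
  · have he : 10 ^ 6 ≤ rootBound D := le_trans (by norm_num) (Nat.le_add_left _ _)
    refine (reach_containsCopy hn he (log_rootBound_le D) fun v =>
      ((card_nbrs H v).trans_le (hD v)).trans (le_rootBound_pow D)).mono ?_ le_rfl fun _ _ h => h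
    have hDR : (D : ℝ) ≠ 0 := by exact_mod_cast hD0.ne'
    have h1 : (1 + excess D) * (D : ℝ) = (rootBound D : ℝ) ^ 16 + 2 * (rootBound D : ℝ) ^ 15 := by
      rw [excess, if_neg hD0.ne', add_sub_cancel, div_mul_cancel₀ _ hDR]
    rw [h1, ← Nat.cast_le (α := ℝ)]
    refine le_trans ?_ (Nat.le_ceil _)
    have h2 : ((rootBound D ^ 16 * n / 2 : ℕ) : ℝ) ≤ (rootBound D : ℝ) ^ 16 * n / 2 := by
      refine Nat.cast_div_le.trans (le_of_eq ?_)
      push_cast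
      rfl
    rw [Nat.cast_add, Nat.cast_mul, Nat.cast_pow]
    linarith

theorem semirandom_tree_bounded_degree (Δ : ℕ → ℕ) (H : ∀ n, SimpleGraph (Fin n))
    (hdeg : ∀ n, ∀ v : Fin n, ((H n).neighborSet v).ncard ≤ Δ n) :
    ∃ f : ℕ → ℝ, (∀ D, 0 ≤ f D) ∧ Tendsto f atTop (nhds 0) ∧
      ∃ σ : ∀ n, TreeStrategy n,
        Tendsto
          (fun n => treeProb n ⌈(1 + f (Δ n)) * (Δ n : ℝ) * (n : ℝ) / 2⌉₊ (σ n) (H n))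
          atTop (nhds 1) := by
  refine ⟨excess, excess_nonneg, tendsto_excess, ?_⟩
  have hσ : ∀ n, ∃ σ : TreeStrategy n, 4 ≤ n → 1 - 2 / (n : ℝ) ≤
      treeProb n ⌈(1 + excess (Δ n)) * (Δ n : ℝ) * (n : ℝ) / 2⌉₊ σ (H n) := fun n => by
    by_cases hn : 4 ≤ n
    · obtain ⟨σ, h⟩ := exists_strategy_treeProb hn (H n) (hdeg n)
      exact ⟨σ, fun _ => h⟩
    · exact ⟨fun _ _ => none, fun h => absurd h hn⟩
  choose σ hσ using hσ
  have hlim : Tendsto (fun n : ℕ => 1 - 2 / (n : ℝ)) atTop (nhds 1) := by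
    simpa using (tendsto_const_div_atTop_nhds_zero_nat 2).const_sub (1 : ℝ)
  refine ⟨σ, tendsto_of_tendsto_of_tendsto_of_le_of_le' hlim tendsto_const_nhds ?_
    (Eventually.of_forall fun n => treeProb_le_one (σ n) (H n))⟩
  filter_upwards [eventually_ge_atTop 4] with n hn using hσ n hn
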